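/- Let (a_n)_{n≥1} be a strictly increasing sequence of positive integers. Then E(A_N) = Ω(N³) (i.e. there exists κ > 0 and a strictly increasing sequence of positive integers N_i with E(A_{N_i}) ≥ κ·N_i³ for all i) if and only if (a_n)_{n≥1} is quasi-arithmetic of some degree d. -/

import Mathlib

/-- The additive energy `E(A) = #{(a,b,c,d) ∈ A⁴ : a + b = c + d}` of a finite set
of integers. -/
def additiveEnergy (A : Finset ℤ) : ℕ :=
  (((A ×ˢ A) ×ˢ (A ×ˢ A)).filter
    (fun p => p.1.1 + p.1.2 = p.2.1 + p.2.2)).card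

/-- `A_N`, the set of the first `N` elements `{a_1, …, a_N}` of the sequence `a`. -/
def firstElems (a : ℕ → ℕ) (N : ℕ) : Finset ℤ :=
  (Finset.Icc 1 N).image (fun n => (a n : ℤ))

/-- The `d`-dimensional arithmetic progression
`{h + ∑ j r_j k_j : 0 ≤ r_j < s_j}`. -/
def genAP (d : ℕ) (h : ℤ) (k s : Fin d → ℤ) : Set ℤ :=
  {x | ∃ r : Fin d → ℤ, (∀ j, 0 ≤ r j ∧ r j < s j) ∧ x = h + ∑ j, r j * k j}

/-- A sequence `(a_n)_{n ≥ 1}` of positive integers is quasi-arithmetic of degree `d`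
if there are constants `C, K > 0` and a strictly increasing sequence `(N_i)` of
positive integers such that for every `i` some subset of `{a_1, …, a_{N_i}}` of
cardinality at least `C·N_i` is contained in a `d`-dimensional arithmetic progression
of size at most `K·N_i`. -/
def QuasiArithmetic (a : ℕ → ℕ) (d : ℕ) : Prop :=
  ∃ C K : ℝ, 0 < C ∧ 0 < K ∧ ∃ N : ℕ → ℕ, StrictMono N ∧ (∀ i, 0 < N i) ∧
    ∀ i, ∃ A : Finset ℤ,
      (∀ x ∈ A, ∃ n, 1 ≤ n ∧ n ≤ N i ∧ (a n : ℤ) = x) ∧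
      C * (N i : ℝ) ≤ (A.card : ℝ) ∧
      ∃ h : ℤ, ∃ k s : Fin d → ℤ,
        (↑A : Set ℤ) ⊆ genAP d h k s ∧ ((∏ j, s j : ℤ) : ℝ) ≤ K * (N i : ℝ)

open Finset in
/-- A `δ`-separated set in a ball of radius `R` has at most `(2 * R / δ + 1) ^ d` elements. -/
theorem card_le_of_separated_of_norm_le {E : Type*} [NormedAddCommGroup E] [NormedSpace ℝ E]
    [FiniteDimensional ℝ E] (s : Finset E) {R δ : ℝ} (hR : 0 ≤ R) (hδ : 0 < δ)
    (hs : ∀ c ∈ s, ‖c‖ ≤ R) (h : ∀ c ∈ s, ∀ d ∈ s, c ≠ d → δ ≤ ‖c - d‖) :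
    (#s : ℝ) ≤ (2 * R / δ + 1) ^ Module.finrank ℝ E := by
  borelize E
  let μ : MeasureTheory.Measure E := MeasureTheory.Measure.addHaar
  have hδ2 : 0 < δ / 2 := by positivity
  have hρ : 0 < R + δ / 2 := by positivity
  have hdisj : (s : Set E).Pairwise (Function.onFun Disjoint fun c => Metric.ball c (δ / 2)) := by
    rintro c hc d hd hcd
    apply Metric.ball_disjoint_ball
    rw [dist_eq_norm]
    linarith [h c hc d hd hcd]
  have hsub : (⋃ c ∈ s, Metric.ball c (δ / 2)) ⊆ Metric.ball (0 : E) (R + δ / 2) := by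
    refine Set.iUnion₂_subset fun x hx => Metric.ball_subset_ball' ?_
    rw [dist_zero_right]
    linarith [hs x hx]
  have hvol : (#s : ENNReal) * ENNReal.ofReal ((δ / 2) ^ Module.finrank ℝ E) *
      μ (Metric.ball 0 1) ≤
      ENNReal.ofReal ((R + δ / 2) ^ Module.finrank ℝ E) * μ (Metric.ball 0 1) := by
    rw [← μ.addHaar_ball_of_pos (0 : E) hρ]
    refine le_trans (le_of_eq ?_) (MeasureTheory.measure_mono hsub)
    rw [MeasureTheory.measure_biUnion_finset hdisj fun c _ => measurableSet_ball]
    simp only [μ.addHaar_ball_of_pos _ hδ2, sum_const, nsmul_eq_mul, mul_assoc]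
  have hvol' := (ENNReal.mul_le_mul_iff_left (Metric.measure_ball_pos μ _ zero_lt_one).ne'
    MeasureTheory.measure_ball_lt_top.ne).1 hvol
  have hreal := ENNReal.toReal_le_of_le_ofReal (pow_nonneg hρ.le _) hvol'
  rw [ENNReal.toReal_mul, ENNReal.toReal_natCast, ENNReal.toReal_ofReal (by positivity)] at hreal
  have heq : 2 * R / δ + 1 = (R + δ / 2) / (δ / 2) := by field_simp
  rw [heq, div_pow, le_div_iff₀ (by positivity)]
  exact hreal

open Finset in
theorem exists_separated_subset_covering {E : Type*} [NormedAddCommGroup E] (S : Finset E)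
    {δ : ℝ} (hδ : 0 < δ) :
    ∃ T ⊆ S, (∀ c ∈ T, ∀ d ∈ T, c ≠ d → δ ≤ ‖c - d‖) ∧ ∀ x ∈ S, ∃ t ∈ T, ‖x - t‖ < δ := by
  classical
  obtain ⟨T, hT, hmax⟩ := exists_max_image
    (S.powerset.filter fun T => ∀ c ∈ T, ∀ d ∈ T, c ≠ d → δ ≤ ‖c - d‖) card ⟨∅, by simp⟩
  rw [mem_filter, mem_powerset] at hT
  refine ⟨T, hT.1, hT.2, fun x hx => ?_⟩
  by_contra! hfar
  have hxT : x ∉ T := fun hxT => by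
    have := hfar x hxT
    rw [sub_self, norm_zero] at this
    linarith
  have := hmax (insert x T) (by
    rw [mem_filter, mem_powerset]
    refine ⟨insert_subset hx hT.1, fun c hc d hd hcd => ?_⟩
    rw [mem_insert] at hc hd
    rcases hc with rfl | hc <;> rcases hd with rfl | hd
    · exact absurd rfl hcd
    · exact hfar d hd
    · rw [norm_sub_rev]; exact hfar c hc
    · exact hT.2 c hc d hd hcd)
  rw [card_insert_of_notMem hxT] at this
  omega

section Lattice

variable {E : Type*} [NormedAddCommGroup E]

/-- The elements of norm at most `r` of an additive subgroup with finite balls. -/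
noncomputable def subgroupBall (Λ : AddSubgroup E)
    (hfin : ∀ r : ℕ, {x | x ∈ Λ ∧ ‖x‖ ≤ r}.Finite) (r : ℕ) : Finset E :=
  (hfin r).toFinset

variable {Λ : AddSubgroup E} {hfin : ∀ r : ℕ, {x | x ∈ Λ ∧ ‖x‖ ≤ r}.Finite}

theorem mem_subgroupBall {r : ℕ} {x : E} : x ∈ subgroupBall Λ hfin r ↔ x ∈ Λ ∧ ‖x‖ ≤ r := by
  simp [subgroupBall]

theorem subgroupBall_mono {r s : ℕ} (h : r ≤ s) :
    subgroupBall Λ hfin r ⊆ subgroupBall Λ hfin s := fun x hx => by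
  rw [mem_subgroupBall] at hx ⊢
  exact ⟨hx.1, hx.2.trans (by exact_mod_cast h)⟩

variable [NormedSpace ℝ E]

open Finset in
theorem card_subgroupBall_le (hint : ∀ x ∈ Λ, ∃ n : ℕ, ‖x‖ = n) {r s : ℕ} (hsr : s + 1 ≤ r) :
    (#(subgroupBall Λ hfin r) : ℝ) ≤
      (3 * (r / (s + 1 : ℕ))) ^
        Module.finrank ℝ (Submodule.span ℝ (subgroupBall Λ hfin r : Set E)) *
        #(subgroupBall Λ hfin s) := by
  classical
  set S := subgroupBall Λ hfin r with hS
  set V := Submodule.span ℝ (S : Set E) with hV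
  have hpos : (0 : ℝ) < (s + 1 : ℕ) := by positivity
  obtain ⟨T, hTS, hsep, hcov⟩ := exists_separated_subset_covering S hpos
  have hTcard : (#T : ℝ) ≤ (3 * (r / (s + 1 : ℕ))) ^ Module.finrank ℝ V := by
    have h1 : #T = #(T.attach.image
        fun x => (⟨x.1, Submodule.subset_span (hTS x.2)⟩ : V)) := by
      rw [card_image_of_injective, card_attach]
      intro x y hxy
      exact Subtype.ext (congrArg (fun z : V => (z : E)) hxy)
    rw [h1]
    refine (card_le_of_separated_of_norm_le (R := r) _ (by positivity) hpos ?_ ?_).trans ?_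
    · intro c hc
      obtain ⟨x, -, rfl⟩ := mem_image.1 hc
      exact (mem_subgroupBall.1 (hTS x.2)).2
    · intro c hc d hd hcd
      obtain ⟨x, -, rfl⟩ := mem_image.1 hc
      obtain ⟨y, -, rfl⟩ := mem_image.1 hd
      refine hsep x x.2 y y.2 fun hxy => hcd ?_
      simp [hxy]
    · gcongr
      have : (1 : ℝ) ≤ r / (s + 1 : ℕ) := by
        rw [le_div_iff₀ hpos, one_mul]
        exact_mod_cast hsr
      rw [mul_div_assoc]
      linarith
  have hle : #S ≤ #T * #(subgroupBall Λ hfin s) := by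
    have hsub : S ⊆ (T ×ˢ subgroupBall Λ hfin s).image fun p => p.1 + p.2 := by
      intro x hx
      obtain ⟨t, ht, hxt⟩ := hcov x hx
      refine mem_image.2 ⟨(t, x - t), mem_product.2 ⟨ht, ?_⟩, by simp⟩
      have hmem : x - t ∈ Λ :=
        Λ.sub_mem (mem_subgroupBall.1 hx).1 (mem_subgroupBall.1 (hTS ht)).1
      refine mem_subgroupBall.2 ⟨hmem, ?_⟩
      obtain ⟨n, hn⟩ := hint _ hmem
      rw [hn] at hxt ⊢
      exact_mod_cast Nat.lt_succ_iff.1 (by exact_mod_cast hxt)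
    calc #S ≤ _ := card_le_card hsub
      _ ≤ _ := card_image_le
      _ = _ := card_product _ _
  calc (#S : ℝ) ≤ #T * #(subgroupBall Λ hfin s) := by exact_mod_cast hle
    _ ≤ _ := by gcongr

open Finset in
/-- An upper bound of Minkowski type for the number of lattice points in a ball, in terms of a
family of short independent vectors. -/
theorem exists_short_independent (hint : ∀ x ∈ Λ, ∃ n : ℕ, ‖x‖ = n) (r : ℕ) :
    ∃ b ⊆ subgroupBall Λ hfin r, LinearIndepOn ℝ id (b : Set E) ∧
      (subgroupBall Λ hfin r : Set E) ⊆ Submodule.span ℝ (b : Set E) ∧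
      (#(subgroupBall Λ hfin r) : ℝ) * ∏ v ∈ b, ‖v‖ ≤ 3 ^ (#b ^ 2) * (r : ℝ) ^ #b := by
  classical
  induction r using Nat.strong_induction_on with
  | _ r ih =>
  have hfr : ∀ (b : Finset E) (t : ℕ), b ⊆ subgroupBall Λ hfin t →
      LinearIndepOn ℝ id (b : Set E) →
      (subgroupBall Λ hfin t : Set E) ⊆ Submodule.span ℝ (b : Set E) →
      #b = Module.finrank ℝ (Submodule.span ℝ (subgroupBall Λ hfin t : Set E)) := by
    intro b t hb hli hsp
    have : Submodule.span ℝ (subgroupBall Λ hfin t : Set E) = Submodule.span ℝ (b : Set E) :=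
      le_antisymm (Submodule.span_le.2 hsp) (Submodule.span_mono (by exact_mod_cast hb))
    rw [this, finrank_span_finset_eq_card hli]
  set f : ℕ → ℕ := fun t =>
    Module.finrank ℝ (Submodule.span ℝ (subgroupBall Λ hfin t : Set E)) with hf
  have hball0 : subgroupBall Λ hfin 0 = {0} := by
    ext x
    simp only [mem_subgroupBall, Nat.cast_zero, norm_le_zero_iff, mem_singleton]
    exact ⟨fun h => h.2, fun h => ⟨h ▸ Λ.zero_mem, h⟩⟩
  have hf0 : f 0 = 0 := by simp [hf, hball0]
  have hex : ∃ t, f t = f r := ⟨r, rfl⟩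
  set t := Nat.find hex with ht
  have htr : t ≤ r := Nat.find_le rfl
  have hft : f t = f r := Nat.find_spec hex
  rcases Nat.eq_zero_or_pos t with ht0 | htpos
  · have hfr0 : f r = 0 := by rw [← hft, ht0, hf0]
    have hspan := Submodule.finrank_eq_zero.1 hfr0
    have hsub : ∀ x ∈ subgroupBall Λ hfin r, x = 0 := fun x hx => by
      have : x ∈ Submodule.span ℝ (subgroupBall Λ hfin r : Set E) :=
        Submodule.subset_span hx
      rwa [hspan, Submodule.mem_bot] at this
    refine ⟨∅, by simp, by simp, fun x hx => by simp [hsub x hx], ?_⟩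
    have : #(subgroupBall Λ hfin r) ≤ 1 :=
      card_le_one.2 fun x hx y hy => (hsub x hx).trans (hsub y hy).symm
    simpa using this
  · obtain ⟨s, hs⟩ : ∃ s, t = s + 1 := ⟨t - 1, by omega⟩
    have hsr : s + 1 ≤ r := hs ▸ htr
    obtain ⟨b₀, hb₀, hli₀, hsp₀, hbd₀⟩ := ih s (by omega)
    have hb₀t : (b₀ : Set E) ⊆ subgroupBall Λ hfin t := by
      exact_mod_cast hb₀.trans (subgroupBall_mono (by omega))
    obtain ⟨b', hb't, hbb', hspan', hli'⟩ := exists_linearIndepOn_id_extension hli₀ hb₀t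
    obtain ⟨b, rfl⟩ : ∃ b : Finset E, (b : Set E) = b' :=
      ⟨((finite_toSet _).subset hb't).toFinset, by simp⟩
    have hbt : b ⊆ subgroupBall Λ hfin t := by exact_mod_cast hb't
    have hb₀b : b₀ ⊆ b := by exact_mod_cast hbb'
    have hbr := hbt.trans (subgroupBall_mono htr)
    have hcardb : #b = f r := by rw [← hft]; exact hfr b t hbt hli' hspan'
    have hcardb₀ : #b₀ = f s := hfr b₀ s hb₀ hli₀ hsp₀
    have hspr : Submodule.span ℝ (subgroupBall Λ hfin r : Set E) =
        Submodule.span ℝ (b : Set E) := by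
      symm
      apply Submodule.eq_of_le_of_finrank_eq (Submodule.span_mono (by exact_mod_cast hbr))
      rw [finrank_span_finset_eq_card hli', hcardb]
    have hlt : #b₀ < #b := by
      rw [hcardb₀, hcardb]
      refine lt_of_le_of_ne ?_ (Nat.find_min hex (by omega))
      exact Submodule.finrank_mono (Submodule.span_mono
        (by exact_mod_cast subgroupBall_mono (by omega)))
    refine ⟨b, hbr, hli', by rw [← hspr]; exact Submodule.subset_span, ?_⟩
    have hN := card_subgroupBall_le (hfin := hfin) hint hsr
    rw [hspr, finrank_span_finset_eq_card hli'] at hN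
    have hprod : ∏ v ∈ b \ b₀, ‖v‖ ≤ ((s + 1 : ℕ) : ℝ) ^ (#b - #b₀) := by
      rw [← card_sdiff_of_subset hb₀b]
      rw [← prod_const]
      refine prod_le_prod (fun v _ => norm_nonneg v) fun v hv => ?_
      rw [← hs]
      exact (mem_subgroupBall.1 (hbt (mem_sdiff.1 hv).1)).2
    have hpos : (0 : ℝ) < (s + 1 : ℕ) := by positivity
    have hsle : (s : ℝ) ≤ (s + 1 : ℕ) := by exact_mod_cast Nat.le_succ s
    calc (#(subgroupBall Λ hfin r) : ℝ) * ∏ v ∈ b, ‖v‖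
        = #(subgroupBall Λ hfin r) * ((∏ v ∈ b \ b₀, ‖v‖) * ∏ v ∈ b₀, ‖v‖) := by
          rw [prod_sdiff hb₀b]
      _ ≤ ((3 * (r / (s + 1 : ℕ))) ^ #b * #(subgroupBall Λ hfin s)) *
            (((s + 1 : ℕ) : ℝ) ^ (#b - #b₀) * ∏ v ∈ b₀, ‖v‖) := by gcongr
      _ = ((3 * (r / (s + 1 : ℕ))) ^ #b * ((s + 1 : ℕ) : ℝ) ^ (#b - #b₀)) *
            (#(subgroupBall Λ hfin s) * ∏ v ∈ b₀, ‖v‖) := by ring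
      _ ≤ ((3 * (r / (s + 1 : ℕ))) ^ #b * ((s + 1 : ℕ) : ℝ) ^ (#b - #b₀)) *
            (3 ^ (#b₀ ^ 2) * (s : ℝ) ^ #b₀) := by gcongr
      _ ≤ ((3 * (r / (s + 1 : ℕ))) ^ #b * ((s + 1 : ℕ) : ℝ) ^ (#b - #b₀)) *
            (3 ^ (#b₀ ^ 2) * ((s + 1 : ℕ) : ℝ) ^ #b₀) := by gcongr
      _ = 3 ^ (#b + #b₀ ^ 2) * ((r / (s + 1 : ℕ)) ^ #b *
            (((s + 1 : ℕ) : ℝ) ^ (#b - #b₀) * ((s + 1 : ℕ) : ℝ) ^ #b₀)) := by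
          rw [mul_pow, pow_add]; ring
      _ = 3 ^ (#b + #b₀ ^ 2) * (r : ℝ) ^ #b := by
          rw [← pow_add, Nat.sub_add_cancel hlt.le, ← mul_pow, div_mul_cancel₀ _ hpos.ne']
      _ ≤ 3 ^ (#b ^ 2) * (r : ℝ) ^ #b := by
          gcongr
          · norm_num
          · nlinarith

open Finset in
/-- A lattice ball of radius `R` contains a proper progression whose size is comparable with the
number of lattice points in the ball. -/
theorem exists_independent_progression [FiniteDimensional ℝ E]
    (hint : ∀ x ∈ Λ, ∃ n : ℕ, ‖x‖ = n) (R : ℕ) :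
    ∃ d ≤ Module.finrank ℝ E, ∃ w : Fin d → E, (∀ i, w i ∈ Λ) ∧ LinearIndependent ℝ w ∧
      ∃ L : Fin d → ℕ, (∀ i, 0 < L i) ∧
        (∀ n : Fin d → ℕ, (∀ i, n i < L i) → ‖∑ i, (n i : ℝ) • w i‖ ≤ R) ∧
        (#(subgroupBall Λ hfin R) : ℝ) ≤
          3 ^ (Module.finrank ℝ E ^ 2) * (Module.finrank ℝ E + 1 : ℝ) ^ Module.finrank ℝ E *
            ∏ i, (L i : ℝ) := by
  classical
  obtain ⟨b, hb, hli, -, hbd⟩ := exists_short_independent (hfin := hfin) hint R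
  have hd : #b ≤ Module.finrank ℝ E := by
    rw [← finrank_span_finset_eq_card hli]
    exact Submodule.finrank_le _
  set w : Fin #b → E := fun i => (b.equivFin.symm i : E) with hw
  have hwb : ∀ i, w i ∈ b := fun i => (b.equivFin.symm i).2
  have hwli : LinearIndependent ℝ w := hli.comp _ b.equivFin.symm.injective
  have hprod : ∏ v ∈ b, ‖v‖ = ∏ i, ‖w i‖ := by
    rw [← prod_coe_sort b fun v => ‖v‖]
    exact (Equiv.prod_comp b.equivFin.symm fun v : b => ‖(v : E)‖).symm
  have hnorm : ∀ i, 0 < ‖w i‖ := fun i => norm_pos_iff.2 (hwli.ne_zero i)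
  rw [hprod] at hbd
  refine ⟨#b, hd, w, fun i => (mem_subgroupBall.1 (hb (hwb i))).1, hwli,
    fun i => ⌊(R : ℝ) / (#b * ‖w i‖)⌋₊ + 1, fun i => Nat.succ_pos _, ?_, ?_⟩
  · intro n hn
    rcases b.eq_empty_or_nonempty with hbe | hbne
    · have : IsEmpty (Fin #b) := by rw [hbe, card_empty]; infer_instance
      simp
    have hbpos : (0 : ℝ) < #b := by exact_mod_cast hbne.card_pos
    calc ‖∑ i, (n i : ℝ) • w i‖ ≤ ∑ i, ‖(n i : ℝ) • w i‖ := norm_sum_le _ _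
      _ ≤ ∑ i : Fin #b, (R : ℝ) / #b := by
          refine sum_le_sum fun i _ => ?_
          have hv0 := hnorm i
          rw [norm_smul, Real.norm_natCast]
          have h1 : (n i : ℝ) ≤ R / (#b * ‖w i‖) :=
            (Nat.le_floor_iff (by positivity)).1 (Nat.lt_succ_iff.1 (hn i))
          calc (n i : ℝ) * ‖w i‖ ≤ R / (#b * ‖w i‖) * ‖w i‖ := by gcongr
            _ = R / #b := by field_simp
      _ = R := by rw [sum_const, nsmul_eq_mul, card_univ, Fintype.card_fin]; field_simp
  · have hP : 0 < ∏ i, ‖w i‖ := prod_pos fun i _ => hnorm i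
    have hL : (R : ℝ) ^ #b ≤
        (#b : ℝ) ^ #b * (∏ i, ((⌊(R : ℝ) / (#b * ‖w i‖)⌋₊ + 1 : ℕ) : ℝ)) * ∏ i, ‖w i‖ := by
      have hcard : ∀ c : ℝ, c ^ #b = ∏ i : Fin #b, c := fun c => by simp
      rw [hcard, hcard, ← prod_mul_distrib, ← prod_mul_distrib]
      refine prod_le_prod (fun _ _ => by positivity) fun i _ => ?_
      have hv0 := hnorm i
      have hbpos : (0 : ℝ) < #b := by exact_mod_cast card_pos.2 ⟨w i, hwb i⟩
      have := (Nat.lt_floor_add_one ((R : ℝ) / (#b * ‖w i‖))).le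
      rw [div_le_iff₀ (by positivity)] at this
      push_cast
      linarith
    have h1 : (#(subgroupBall Λ hfin R) : ℝ) ≤ 3 ^ (#b ^ 2) * (#b : ℝ) ^ #b *
        ∏ i, ((⌊(R : ℝ) / (#b * ‖w i‖)⌋₊ + 1 : ℕ) : ℝ) := by
      refine le_of_mul_le_mul_right (hbd.trans ?_) hP
      calc (3 : ℝ) ^ (#b ^ 2) * (R : ℝ) ^ #b ≤ 3 ^ (#b ^ 2) * _ :=
            mul_le_mul_of_nonneg_left hL (by positivity)
        _ = _ := by ring
    refine h1.trans ?_
    have h2 : (#b : ℝ) ^ #b ≤ (Module.finrank ℝ E + 1 : ℝ) ^ Module.finrank ℝ E := by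
      have : #b ^ #b ≤ (Module.finrank ℝ E + 1) ^ Module.finrank ℝ E :=
        (Nat.pow_le_pow_left (hd.trans (Nat.le_succ _)) _).trans
          (Nat.pow_le_pow_right (Nat.succ_pos _) hd)
      exact_mod_cast this
    have h3 : (3 : ℝ) ^ (#b ^ 2) ≤ 3 ^ (Module.finrank ℝ E ^ 2) :=
      pow_le_pow_right₀ (by norm_num) (Nat.pow_le_pow_left hd 2)
    gcongr

end Lattice

theorem norm_intCast_pi_mem_range {ι : Type*} [Fintype ι] (u : ι → ℤ) :
    ∃ n : ℕ, ‖fun i => (u i : ℝ)‖ = n := by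
  rcases isEmpty_or_nonempty ι with h | h
  · exact ⟨0, by simp [Pi.norm_def]⟩
  · obtain ⟨i, -, hi⟩ := Finset.exists_mem_eq_sup Finset.univ Finset.univ_nonempty
      fun i => ‖(u i : ℝ)‖₊
    refine ⟨(u i).natAbs, ?_⟩
    rw [Pi.norm_def, hi, coe_nnnorm, Real.norm_eq_abs, Nat.cast_natAbs, Int.cast_abs]

/-- The lattice of integer vectors congruent modulo `m` to a multiple of the vector of
frequencies in `Γ`. -/
def frequencyLattice {m : ℕ} (Γ : Finset (ZMod m)) : AddSubgroup (Γ → ℝ) where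
  carrier := {v | ∃ (u : Γ → ℤ) (y : ZMod m), (v = fun ξ => (u ξ : ℝ)) ∧
    ∀ ξ, (u ξ : ZMod m) = y * ξ}
  zero_mem' := ⟨0, 0, by ext; simp, by simp⟩
  add_mem' := by
    rintro _ _ ⟨u, y, rfl, hu⟩ ⟨u', y', rfl, hu'⟩
    exact ⟨u + u', y + y', by ext; simp, fun ξ => by simp [hu, hu', add_mul]⟩
  neg_mem' := by
    rintro _ ⟨u, y, rfl, hu⟩
    exact ⟨-u, -y, by ext; simp, fun ξ => by simp [hu]⟩

theorem finite_frequencyLattice_ball {m : ℕ} (Γ : Finset (ZMod m)) (r : ℕ) :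
    {x | x ∈ frequencyLattice Γ ∧ ‖x‖ ≤ r}.Finite := by
  refine ((Set.finite_Icc (fun _ : Γ => -(r : ℤ)) fun _ => (r : ℤ)).image
    fun u ξ => (u ξ : ℝ)).subset ?_
  rintro _ ⟨⟨u, y, rfl, -⟩, hv⟩
  refine ⟨u, ⟨fun ξ => ?_, fun ξ => ?_⟩, rfl⟩ <;>
  · have := (norm_le_pi_norm (fun ξ => (u ξ : ℝ)) ξ).trans hv
    rw [Real.norm_eq_abs, abs_le] at this
    first
      | exact_mod_cast this.1
      | exact_mod_cast this.2

open Finset in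
theorem le_card_frequencyLattice_ball {m : ℕ} [NeZero m] {Γ : Finset (ZMod m)} (h1 : 1 ∈ Γ) :
    (m : ℝ) / 4 ^ #Γ ≤
      #(subgroupBall (frequencyLattice Γ) (finite_frequencyLattice_ball Γ) (m / 4)) := by
  classical
  have hm : 0 < m := NeZero.pos m
  set c : ZMod m → Γ → Fin 4 := fun y ξ =>
    ⟨4 * (y * ξ).val / m, by
      rw [Nat.div_lt_iff_lt_mul hm]
      have := (y * (ξ : ZMod m)).val_lt
      omega⟩ with hc
  obtain ⟨z, -, hz⟩ := exists_le_card_fiber_of_nsmul_le_card_of_maps_to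
    (s := univ) (t := univ) (f := c) (b := (m : ℝ) / 4 ^ #Γ) (fun _ _ => mem_univ _)
    univ_nonempty (by
      rw [card_univ, card_univ, ZMod.card, nsmul_eq_mul]
      simp only [Fintype.card_pi, Fintype.card_fin, prod_const, card_univ, Fintype.card_coe]
      push_cast
      rw [mul_div_cancel₀ _ (by positivity)])
  refine hz.trans (Nat.cast_le.2 ?_)
  rcases (univ.filter fun x => c x = z).eq_empty_or_nonempty with he | ⟨y₀, hy₀⟩
  · simp [he]
  refine card_le_card_of_injOn
    (fun y ξ => (((y * ξ).val : ℤ) - ((y₀ * ξ).val : ℤ) : ℤ)) ?_ ?_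
  · intro y hy
    have hyy₀ : c y = c y₀ := (mem_filter.1 hy).2.trans (mem_filter.1 hy₀).2.symm
    refine mem_subgroupBall.2 ⟨⟨_, y - y₀, rfl, fun ξ => ?_⟩, ?_⟩
    · simp [sub_mul]
    · rw [pi_norm_le_iff_of_nonneg (by positivity)]
      intro ξ
      have h := congrArg Fin.val (congrFun hyy₀ ξ)
      simp only [hc] at h
      have e1 := Nat.div_add_mod (4 * (y * (ξ : ZMod m)).val) m
      have e2 := Nat.div_add_mod (4 * (y₀ * (ξ : ZMod m)).val) m
      have e3 := Nat.mod_lt (4 * (y * (ξ : ZMod m)).val) hm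
      have e4 := Nat.mod_lt (4 * (y₀ * (ξ : ZMod m)).val) hm
      rw [h] at e1
      have : |((y * (ξ : ZMod m)).val : ℤ) - ((y₀ * (ξ : ZMod m)).val : ℤ)| ≤ (m / 4 : ℕ) := by
        rw [abs_le]
        omega
      rw [Real.norm_eq_abs]
      have h' := (Int.cast_le (R := ℝ)).2 this
      rwa [Int.cast_abs, Int.cast_natCast] at h'
  · intro y _ y' _ h
    have h := congrFun h ⟨1, h1⟩
    simp only [mul_one, Int.cast_inj, sub_left_inj, Nat.cast_inj] at h
    exact ZMod.val_injective m h

open Finset in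
/-- A Bohr set in `ZMod m` contains a large proper progression. -/
theorem exists_progression_bohr {m : ℕ} [NeZero m] {Γ : Finset (ZMod m)} (h1 : 1 ∈ Γ) :
    ∃ d ≤ #Γ, ∃ (x : Fin d → ZMod m) (L : Fin d → ℕ), (∀ i, 0 < L i) ∧
      (∀ n : Fin d → ℕ, (∀ i, n i < L i) → ∀ ξ ∈ Γ, ∃ v : ℤ,
        (v : ZMod m) = (∑ i, n i * x i) * ξ ∧ 4 * |v| ≤ m) ∧
      (∀ n n' : Fin d → ℕ, (∀ i, n i < L i) → (∀ i, n' i < L i) →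
        ∑ i, n i * x i = ∑ i, n' i * x i → n = n') ∧
      (m : ℝ) ≤ 4 ^ #Γ * (3 ^ (#Γ ^ 2) * (#Γ + 1 : ℝ) ^ #Γ) * ∏ i, (L i : ℝ) := by
  classical
  have hm : 0 < m := NeZero.pos m
  obtain ⟨d, hd, w, hw, hli, L, hL, hbox, hsize⟩ :=
    exists_independent_progression (hfin := finite_frequencyLattice_ball Γ)
      (by rintro _ ⟨u, -, rfl, -⟩; exact norm_intCast_pi_mem_range u) (m / 4)
  rw [Module.finrank_fintype_fun_eq_card, Fintype.card_coe] at hd hsize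
  choose u x hwu hux using hw
  have hval : ∀ (n : Fin d → ℕ) (ξ : Γ),
      (∑ i, (n i : ℝ) • w i) ξ = ((∑ i, n i * u i ξ : ℤ) : ℝ) := by
    intro n ξ
    rw [Finset.sum_apply]
    push_cast
    refine sum_congr rfl fun i _ => ?_
    rw [Pi.smul_apply, congrFun (hwu i) ξ, smul_eq_mul]
  have hcong : ∀ (n : Fin d → ℕ) (ξ : Γ),
      ((∑ i, n i * u i ξ : ℤ) : ZMod m) = (∑ i, n i * x i) * ξ := by
    intro n ξ
    push_cast
    rw [sum_mul]
    exact sum_congr rfl fun i _ => by rw [hux, mul_assoc]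
  have hsmall : ∀ n : Fin d → ℕ, (∀ i, n i < L i) → ∀ ξ : Γ,
      4 * |∑ i, n i * u i ξ| ≤ m := by
    intro n hn ξ
    have h := (norm_le_pi_norm _ ξ).trans (hbox n hn)
    rw [hval, Real.norm_eq_abs, ← Int.cast_abs, ← Int.cast_natCast, Int.cast_le] at h
    omega
  refine ⟨d, hd, x, L, hL, fun n hn ξ hξ => ⟨_, hcong n ⟨ξ, hξ⟩, hsmall n hn ⟨ξ, hξ⟩⟩, ?_, ?_⟩
  · intro n n' hn hn' h
    have heq : ∑ i, (n i : ℝ) • w i = ∑ i, (n' i : ℝ) • w i := by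
      ext ξ
      rw [hval, hval, Int.cast_inj]
      have hz : (((∑ i, n i * u i ξ) - ∑ i, n' i * u i ξ : ℤ) : ZMod m) = 0 := by
        rw [Int.cast_sub, hcong, hcong, h, sub_self]
      rw [ZMod.intCast_zmod_eq_zero_iff_dvd] at hz
      have b1 := hsmall n hn ξ
      have b2 := hsmall n' hn' ξ
      refine sub_eq_zero.1 (Int.eq_zero_of_abs_lt_dvd hz ?_)
      have := abs_sub (∑ i, n i * u i ξ) (∑ i, n' i * u i ξ)
      omega
    have := Fintype.linearIndependent_iff.1 hli (fun i => (n i : ℝ) - n' i) (by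
      simp only [sub_smul, sum_sub_distrib, heq, sub_self])
    ext i
    exact_mod_cast sub_eq_zero.1 (this i)
  · have := (le_card_frequencyLattice_ball h1).trans hsize
    rw [div_le_iff₀ (by positivity)] at this
    linarith

open Finset in
theorem sum_stdAddChar_mul {m : ℕ} [NeZero m] (z : ZMod m) :
    ∑ ξ : ZMod m, ZMod.stdAddChar (z * ξ) = if z = 0 then (m : ℂ) else 0 := by
  simp_rw [mul_comm z]
  rw [AddChar.sum_mulShift z (ZMod.isPrimitive_stdAddChar m), ZMod.card]
  split_ifs <;> simp

/-- The exponential sum over a finite set of residues. -/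
noncomputable def expSum {m : ℕ} [NeZero m] (B : Finset (ZMod m)) (ξ : ZMod m) : ℂ :=
  ∑ b ∈ B, ZMod.stdAddChar (b * ξ)

open ComplexConjugate in
theorem conj_expSum {m : ℕ} [NeZero m] (B : Finset (ZMod m)) (ξ : ZMod m) :
    conj (expSum B ξ) = ∑ b ∈ B, ZMod.stdAddChar (-(b * ξ)) := by
  rw [expSum, map_sum]
  exact Finset.sum_congr rfl fun b _ => (AddChar.map_neg_eq_conj _ _).symm

open Finset ComplexConjugate in
theorem sum_norm_expSum_sq {m : ℕ} [NeZero m] (B : Finset (ZMod m)) :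
    ∑ ξ, ‖expSum B ξ‖ ^ 2 = m * #B := by
  have h : ∑ ξ, ((‖expSum B ξ‖ ^ 2 : ℝ) : ℂ) = m * #B := by
    calc ∑ ξ, ((‖expSum B ξ‖ ^ 2 : ℝ) : ℂ)
        = ∑ ξ, ∑ a ∈ B, ∑ b ∈ B, ZMod.stdAddChar ((a - b) * ξ) := by
          refine sum_congr rfl fun ξ _ => ?_
          rw [Complex.ofReal_pow, ← Complex.mul_conj', conj_expSum, expSum, sum_mul_sum]
          refine sum_congr rfl fun a _ => sum_congr rfl fun b _ => ?_
          rw [← AddChar.map_add_eq_mul]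
          congr 1
          ring
      _ = ∑ a ∈ B, ∑ b ∈ B, ∑ ξ, ZMod.stdAddChar ((a - b) * ξ) := by
          rw [sum_comm]
          exact sum_congr rfl fun a _ => sum_comm
      _ = m * #B := by
          simp_rw [sum_stdAddChar_mul, sub_eq_zero]
          simp [mul_comm]
  exact_mod_cast h

open Finset ComplexConjugate in
theorem sum_norm_expSum_pow_four_mul {m : ℕ} [NeZero m] (B : Finset (ZMod m)) {x : ZMod m}
    (hx : ∀ a ∈ B, ∀ b ∈ B, ∀ c ∈ B, ∀ d ∈ B, x ≠ a + b - c - d) :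
    ∑ ξ, ((‖expSum B ξ‖ ^ 4 : ℝ) : ℂ) * ZMod.stdAddChar (-(x * ξ)) = 0 := by
  calc ∑ ξ, ((‖expSum B ξ‖ ^ 4 : ℝ) : ℂ) * ZMod.stdAddChar (-(x * ξ))
      = ∑ ξ, ∑ p ∈ (B ×ˢ B) ×ˢ (B ×ˢ B),
          ZMod.stdAddChar ((p.1.1 - p.1.2 + (p.2.1 - p.2.2) - x) * ξ) := by
        refine sum_congr rfl fun ξ _ => ?_
        have h4 : ((‖expSum B ξ‖ ^ 4 : ℝ) : ℂ) =
            (expSum B ξ * conj (expSum B ξ)) * (expSum B ξ * conj (expSum B ξ)) := by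
          rw [Complex.mul_conj']
          push_cast
          ring
        rw [h4, conj_expSum, expSum, sum_mul_sum, ← sum_product', sum_mul_sum, ← sum_product',
          sum_mul]
        refine sum_congr rfl fun p _ => ?_
        simp only [← AddChar.map_add_eq_mul]
        congr 1
        ring
    _ = ∑ p ∈ (B ×ˢ B) ×ˢ (B ×ˢ B), ∑ ξ,
          ZMod.stdAddChar ((p.1.1 - p.1.2 + (p.2.1 - p.2.2) - x) * ξ) := sum_comm
    _ = 0 := by
        refine sum_eq_zero fun p hp => ?_
        simp only [mem_product] at hp
        rw [sum_stdAddChar_mul, if_neg]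
        intro h
        refine hx p.1.1 hp.1.1 p.2.1 hp.2.1 p.1.2 hp.1.2 p.2.2 hp.2.2 ?_
        rw [sub_eq_zero] at h
        rw [← h]
        ring

theorem re_stdAddChar_neg_nonneg {m : ℕ} [NeZero m] {v : ℤ} (hv : 4 * |v| ≤ m) :
    0 ≤ (ZMod.stdAddChar (-(v : ZMod m)) : ℂ).re := by
  have hm : (0 : ℝ) < m := by exact_mod_cast NeZero.pos m
  have hv' : 4 * |(v : ℝ)| ≤ m := by exact_mod_cast hv
  have hb : |(v : ℝ) / m| ≤ 1 / 4 := by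
    rw [abs_div, abs_of_pos hm, div_le_iff₀ hm]
    linarith
  rw [abs_le] at hb
  have harg : 2 * (Real.pi : ℂ) * Complex.I * ((-v : ℤ) : ℂ) / m =
      ((2 * Real.pi * (-(v / m)) : ℝ) : ℂ) * Complex.I := by
    push_cast
    ring
  rw [← Int.cast_neg, ZMod.stdAddChar_coe, harg, Complex.exp_ofReal_mul_I_re]
  apply Real.cos_nonneg_of_neg_pi_div_two_le_of_le <;> nlinarith [Real.pi_pos]

open Finset in
/-- **Bogolyubov's lemma** in `ZMod m`. -/
theorem exists_bohr_subset_two_sub_two {m : ℕ} [NeZero m] {B : Finset (ZMod m)}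
    (hB : B.Nonempty) :
    ∃ Γ : Finset (ZMod m), 1 ∈ Γ ∧ (#Γ : ℝ) ≤ 2 * (m / #B : ℝ) ^ 2 + 1 ∧
      ∀ x, (∀ ξ ∈ Γ, ∃ v : ℤ, (v : ZMod m) = x * ξ ∧ 4 * |v| ≤ m) →
        ∃ a ∈ B, ∃ b ∈ B, ∃ c ∈ B, ∃ d ∈ B, x = a + b - c - d := by
  classical
  have hm : (0 : ℝ) < m := by exact_mod_cast NeZero.pos m
  have hBpos : (0 : ℝ) < #B := by exact_mod_cast hB.card_pos
  have hBm : (#B : ℝ) ≤ m := by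
    have := card_le_univ B
    rw [ZMod.card] at this
    exact_mod_cast this
  set τ : ℝ := #B ^ 3 / (2 * m) with hτ
  have hτpos : 0 < τ := by positivity
  set Γ₀ : Finset (ZMod m) := univ.filter fun ξ => τ ≤ ‖expSum B ξ‖ ^ 2 with hΓ₀
  have hzero : expSum B 0 = #B := by simp [expSum]
  have h0 : 0 ∈ Γ₀ := by
    rw [hΓ₀, mem_filter]
    refine ⟨mem_univ _, ?_⟩
    rw [hzero, Complex.norm_natCast, hτ, div_le_iff₀ (by positivity)]
    nlinarith [sq_nonneg (#B : ℝ), mul_le_mul_of_nonneg_left hBm (sq_nonneg (#B : ℝ))]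
  have hcard : (#Γ₀ : ℝ) ≤ 2 * (m / #B : ℝ) ^ 2 := by
    have h1 : (#Γ₀ : ℝ) * τ ≤ m * #B := by
      rw [← sum_norm_expSum_sq B, ← nsmul_eq_mul]
      refine (card_nsmul_le_sum _ _ _ fun ξ hξ => (mem_filter.1 hξ).2).trans ?_
      exact sum_le_sum_of_subset_of_nonneg (subset_univ _) fun _ _ _ => by positivity
    rw [hτ, mul_div_assoc', div_le_iff₀ (by positivity)] at h1
    rw [div_pow, mul_div_assoc', le_div_iff₀ (by positivity)]
    refine le_of_mul_le_mul_right ?_ hBpos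
    linarith
  refine ⟨insert 1 Γ₀, mem_insert_self _ _, ?_, fun x hx => ?_⟩
  · have : (#(insert 1 Γ₀) : ℝ) ≤ #Γ₀ + 1 := by exact_mod_cast card_insert_le _ _
    linarith
  · by_contra! hne
    have hsum := congrArg Complex.re (sum_norm_expSum_pow_four_mul B hne)
    simp only [Complex.re_sum, Complex.re_ofReal_mul, Complex.zero_re] at hsum
    rw [← sum_add_sum_compl Γ₀] at hsum
    have h1 : (#B : ℝ) ^ 4 ≤
        ∑ ξ ∈ Γ₀, ‖expSum B ξ‖ ^ 4 * (ZMod.stdAddChar (-(x * ξ)) : ℂ).re := by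
      have hterm := single_le_sum (s := Γ₀)
        (f := fun ξ => ‖expSum B ξ‖ ^ 4 * (ZMod.stdAddChar (-(x * ξ)) : ℂ).re)
        (fun ξ hξ => by
          obtain ⟨v, hv, hv4⟩ := hx ξ (mem_insert_of_mem hξ)
          have := re_stdAddChar_neg_nonneg hv4
          rw [hv] at this
          positivity) h0
      simpa [hzero] using hterm
    have h2 : -((#B : ℝ) ^ 4 / 2) ≤
        ∑ ξ ∈ Γ₀ᶜ, ‖expSum B ξ‖ ^ 4 * (ZMod.stdAddChar (-(x * ξ)) : ℂ).re := by
      have h3 : ∀ ξ ∈ Γ₀ᶜ, -(τ * ‖expSum B ξ‖ ^ 2) ≤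
          ‖expSum B ξ‖ ^ 4 * (ZMod.stdAddChar (-(x * ξ)) : ℂ).re := by
        intro ξ hξ
        have hlt : ‖expSum B ξ‖ ^ 2 < τ := by simpa [hΓ₀] using hξ
        have hre := (abs_le.1 (Complex.abs_re_le_norm (ZMod.stdAddChar (-(x * ξ))))).1
        rw [AddChar.norm_apply] at hre
        have hsq : ‖expSum B ξ‖ ^ 4 ≤ τ * ‖expSum B ξ‖ ^ 2 := by
          nlinarith [sq_nonneg ‖expSum B ξ‖]
        nlinarith [pow_nonneg (norm_nonneg (expSum B ξ)) 4]
      refine le_trans ?_ (sum_le_sum h3)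
      rw [sum_neg_distrib, ← mul_sum, neg_le_neg_iff]
      calc τ * ∑ ξ ∈ Γ₀ᶜ, ‖expSum B ξ‖ ^ 2 ≤ τ * ∑ ξ, ‖expSum B ξ‖ ^ 2 := by
            gcongr
            exact subset_univ _
        _ = #B ^ 4 / 2 := by
            rw [sum_norm_expSum_sq, hτ]
            field_simp
    have : (0 : ℝ) < #B ^ 4 := by positivity
    linarith

open scoped Pointwise in
theorem multiset_sum_mem_card_nsmul {G : Type*} [AddCommMonoid G] [DecidableEq G] {A : Finset G}
    (s : Multiset G) (hs : ∀ x ∈ s, x ∈ A) : s.sum ∈ Multiset.card s • A := by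
  induction s using Multiset.induction_on with
  | empty => simp
  | cons a s ih =>
    rw [Multiset.sum_cons, Multiset.card_cons, succ_nsmul']
    exact Finset.add_mem_add (hs a (Multiset.mem_cons_self a s))
      (ih fun x hx => hs x (Multiset.mem_cons_of_mem hx))

open Finset in
/-- For most residues `l` modulo `p`, no nonzero element of `D` is dilated by `l` to a residue
represented by a small multiple of `m`. -/
theorem exists_dilation_avoiding_multiples {p m : ℕ} [Fact p.Prime] (hm : 0 < m) (D : Finset ℤ)
    (hD : ∀ d ∈ D, (d : ZMod p) ≠ 0) (hDm : 4 * #D ≤ m) (hp : 2 * #D < p) :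
    ∃ l : ZMod p, ∀ d ∈ D, ∀ z : ℤ, |z| < p → (z : ZMod p) = l * d → ¬ (m : ℤ) ∣ z := by
  classical
  set Z : Finset ℤ := (Icc (-((p / m : ℕ) : ℤ)) ((p / m : ℕ) : ℤ)).image fun k => m * k with hZ
  set bad : Finset (ZMod p) := (D ×ˢ Z).image fun q => (q.2 : ZMod p) * (q.1 : ZMod p)⁻¹ with hbad
  have hZcard : #Z ≤ 2 * (p / m) + 1 := by
    refine card_image_le.trans ?_
    rw [Int.card_Icc]
    omega
  have hbadcard : #bad < #(univ : Finset (ZMod p)) := by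
    rw [card_univ, ZMod.card]
    refine (card_image_le.trans (card_product _ _).le).trans_lt ?_
    calc #D * #Z ≤ #D * (2 * (p / m) + 1) := Nat.mul_le_mul_left _ hZcard
      _ < p := by
        have h1 : m * (p / m) ≤ p := Nat.mul_div_le p m
        have h2 : 4 * #D * (p / m) ≤ m * (p / m) := Nat.mul_le_mul_right _ hDm
        nlinarith
  obtain ⟨l, -, hl⟩ := exists_mem_notMem_of_card_lt_card hbadcard
  refine ⟨l, fun d hd z hz hzl ⟨k, hk⟩ => hl ?_⟩
  refine mem_image.2 ⟨(d, z), mem_product.2 ⟨hd, mem_image.2 ⟨k, ?_, hk.symm⟩⟩, ?_⟩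
  · rw [hk, abs_mul, Nat.abs_cast] at hz
    have : |k| ≤ ((p / m : ℕ) : ℤ) := by
      rw [Int.natCast_div, Int.le_ediv_iff_mul_le (by exact_mod_cast hm)]
      linarith
    rw [mem_Icc]
    exact abs_le.1 this
  · simp only [hzl]
    rw [mul_assoc, mul_inv_cancel₀ (hD d hd), mul_one]

open Finset in
open scoped Pointwise in
/-- **Ruzsa's model lemma**: a large part of `A` is Freiman isomorphic of order `8` to a
subset of `ZMod m`, as soon as `m` is large compared with `8A - 8A`. -/
theorem exists_freiman_model (A : Finset ℤ) {m : ℕ} (hm : 0 < m)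
    (hAm : 4 * #(8 • A - 8 • A) ≤ m) :
    ∃ A' ⊆ A, #A ≤ 8 * #A' ∧ ∃ φ : ℤ → ZMod m, ∀ s t : Multiset ℤ,
      (∀ x ∈ s, x ∈ A') → (∀ x ∈ t, x ∈ A') → Multiset.card s = 8 → Multiset.card t = 8 →
        ((s.map φ).sum = (t.map φ).sum ↔ s.sum = t.sum) := by
  classical
  set D := (8 • A - 8 • A).erase 0 with hDdef
  obtain ⟨p, hpge, hp⟩ := Nat.exists_infinite_primes (2 * #D + 1 + ∑ d ∈ D, d.natAbs)
  have : Fact p.Prime := ⟨hp⟩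
  have hppos : 0 < p := hp.pos
  have hD : ∀ d ∈ D, (d : ZMod p) ≠ 0 := by
    intro d hd h0
    rw [ZMod.intCast_zmod_eq_zero_iff_dvd] at h0
    have h1 : d.natAbs ≤ ∑ d ∈ D, d.natAbs :=
      single_le_sum (f := fun d : ℤ => d.natAbs) (fun _ _ => Nat.zero_le _) hd
    refine (mem_erase.1 hd).1 (Int.eq_zero_of_abs_lt_dvd h0 ?_)
    rw [Int.abs_eq_natAbs]
    omega
  have hDcard : #D ≤ #(8 • A - 8 • A) := card_le_card (erase_subset _ _)
  obtain ⟨l, hl⟩ := exists_dilation_avoiding_multiples hm D hD (by omega) (by omega)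
  set g : ℤ → ℕ := fun x => (l * (x : ZMod p)).val with hg
  have hglt : ∀ x, g x < p := fun x => ZMod.val_lt _
  obtain ⟨j, -, hj⟩ := exists_le_card_fiber_of_nsmul_le_card_of_maps_to
    (s := A) (t := range 8) (f := fun x => 8 * g x / p) (b := (#A : ℝ) / 8)
    (fun x _ => by
      rw [mem_range, Nat.div_lt_iff_lt_mul hppos]
      have := hglt x
      omega) ⟨0, by simp⟩ (by rw [card_range, nsmul_eq_mul]; push_cast; linarith)
  set A' := A.filter fun x => 8 * g x / p = j with hA'
  have hgs : ∀ s : Multiset ℤ, (∀ x ∈ s, x ∈ A') → Multiset.card s = 8 →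
      j * p ≤ (s.map g).sum ∧ (s.map g).sum < (j + 1) * p := by
    have hx : ∀ x ∈ A', j * p ≤ 8 * g x ∧ 8 * g x + 1 ≤ (j + 1) * p := by
      intro x hx
      have h := (mem_filter.1 hx).2
      rw [← h]
      exact ⟨Nat.div_mul_le_self _ _, by
        have := Nat.lt_div_mul_add (a := 8 * g x) hppos
        rw [add_mul, one_mul]
        omega⟩
    intro s hs h8
    have h1 := Multiset.card_nsmul_le_sum (s := s.map fun x => 8 * g x) (a := j * p) (by
      simp only [Multiset.mem_map]
      rintro _ ⟨x, hxs, rfl⟩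
      exact (hx x (hs x hxs)).1)
    have h2 := Multiset.sum_le_card_nsmul (s.map fun x => 8 * g x + 1) ((j + 1) * p) (by
      simp only [Multiset.mem_map]
      rintro _ ⟨x, hxs, rfl⟩
      exact (hx x (hs x hxs)).2)
    rw [Multiset.sum_map_add] at h2
    simp only [Multiset.card_map, h8, smul_eq_mul, Multiset.sum_map_mul_left, Multiset.map_const',
      Multiset.sum_replicate] at h1 h2
    constructor <;> omega
  have hcast : ∀ s : Multiset ℤ, (((s.map g).sum : ℕ) : ZMod p) = l * (s.sum : ℤ) := by
    intro s
    induction s using Multiset.induction_on with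
    | empty => simp
    | cons a s ih =>
      rw [Multiset.map_cons, Multiset.sum_cons, Nat.cast_add, ih, Multiset.sum_cons, Int.cast_add,
        mul_add, hg, ZMod.natCast_zmod_val]
  refine ⟨A', filter_subset _ _, ?_, fun x => (g x : ZMod m), fun s t hs ht hs8 ht8 => ?_⟩
  · have : (#A : ℝ) ≤ 8 * #A' := by linarith
    exact_mod_cast this
  · have hφ : ∀ s : Multiset ℤ, (s.map fun x => (g x : ZMod m)).sum = ((s.map g).sum : ℕ) := by
      intro s
      rw [Nat.cast_multiset_sum, Multiset.map_map]
      rfl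
    have hs1 := hgs s hs hs8
    have ht1 := hgs t ht ht8
    set z : ℤ := ((s.map g).sum : ℤ) - ((t.map g).sum : ℤ) with hz
    have hzlt : |z| < p := by
      rw [add_mul, one_mul] at hs1 ht1
      rw [abs_lt]
      omega
    have hzcast : (z : ZMod p) = l * ((s.sum - t.sum : ℤ) : ZMod p) := by
      rw [hz, Int.cast_sub, Int.cast_natCast, Int.cast_natCast, hcast, hcast]
      push_cast
      ring
    have hzm : ((s.map g).sum : ZMod m) = ((t.map g).sum : ZMod m) ↔ (m : ℤ) ∣ z := by
      rw [← ZMod.intCast_zmod_eq_zero_iff_dvd, hz, Int.cast_sub, sub_eq_zero]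
      simp
    rw [hφ, hφ, hzm]
    constructor
    · intro hdvd
      by_contra hne
      refine hl (s.sum - t.sum) (mem_erase.2 ⟨sub_ne_zero.2 hne, ?_⟩) z hzlt hzcast hdvd
      have h1 := multiset_sum_mem_card_nsmul (A := A) s fun x hx => filter_subset _ _ (hs x hx)
      have h2 := multiset_sum_mem_card_nsmul (A := A) t fun x hx => filter_subset _ _ (ht x hx)
      rw [hs8] at h1
      rw [ht8] at h2
      exact sub_mem_sub h1 h2
    · intro heq
      rw [heq, sub_self, Int.cast_zero, mul_zero, ZMod.intCast_zmod_eq_zero_iff_dvd] at hzcast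
      rw [Int.eq_zero_of_abs_lt_dvd hzcast hzlt]
      exact dvd_zero _

open Finset in
open scoped Classical in
/-- **Dependent random choice**: a dense relation on `A` admits a large set `U` of vertices, only
a small proportion of whose pairs have few common neighbours. -/
theorem exists_large_subset_few_bad_pairs {V : Type*} (A : Finset V) (R : V → V → Prop)
    {α ε : ℝ} (hα : 0 < α) (hε : 0 < ε) (hA : A.Nonempty)
    (h : α * #A ^ 2 ≤ #{p ∈ A ×ˢ A | R p.1 p.2}) :
    ∃ U ⊆ A, α ^ 2 / 2 * #A ^ 2 ≤ (#U : ℝ) ^ 2 ∧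
      (#{p ∈ U ×ˢ U | (#{b ∈ A | R p.1 b ∧ R p.2 b} : ℝ) < ε * α ^ 2 / 2 * #A} : ℝ)
        ≤ ε * #U ^ 2 := by
  have hN : 0 < (#A : ℝ) := by exact_mod_cast hA.card_pos
  set U : V → Finset V := fun b => A.filter fun a => R a b with hU
  set bad : Finset (V × V) :=
    (A ×ˢ A).filter fun p => (#{b ∈ A | R p.1 b ∧ R p.2 b} : ℝ) < ε * α ^ 2 / 2 * #A with hbad
  have hedge : (#{p ∈ A ×ˢ A | R p.1 p.2} : ℝ) = ∑ b ∈ A, (#(U b) : ℝ) := by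
    rw [card_filter, sum_product_right]
    push_cast [hU, card_filter]
    rfl
  have hsq : α ^ 2 * #A ^ 3 ≤ ∑ b ∈ A, (#(U b) : ℝ) ^ 2 := by
    have h1 := sq_sum_le_card_mul_sum_sq (s := A) (f := fun b => (#(U b) : ℝ))
    rw [← hedge] at h1
    have h2 : (α * #A ^ 2) ^ 2 ≤ (#{p ∈ A ×ˢ A | R p.1 p.2} : ℝ) ^ 2 := by gcongr
    refine le_of_mul_le_mul_left ?_ hN
    calc (#A : ℝ) * (α ^ 2 * #A ^ 3) = (α * #A ^ 2) ^ 2 := by ring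
      _ ≤ _ := h2.trans h1
  have hbadsum : ∑ b ∈ A, (#{p ∈ bad | R p.1 b ∧ R p.2 b} : ℝ) ≤ ε * α ^ 2 / 2 * #A ^ 3 := by
    calc ∑ b ∈ A, (#{p ∈ bad | R p.1 b ∧ R p.2 b} : ℝ)
        = ∑ p ∈ bad, (#{b ∈ A | R p.1 b ∧ R p.2 b} : ℝ) := by
          push_cast [card_filter]
          exact sum_comm
      _ ≤ ∑ p ∈ bad, ε * α ^ 2 / 2 * #A := sum_le_sum fun p hp => (mem_filter.1 hp).2.le
      _ = #bad * (ε * α ^ 2 / 2 * #A) := by rw [sum_const, nsmul_eq_mul]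
      _ ≤ (#A * #A) * (ε * α ^ 2 / 2 * #A) := by
          gcongr
          exact_mod_cast (card_filter_le _ _).trans (card_product A A).le
      _ = _ := by ring
  obtain ⟨b, hb, hle⟩ : ∃ b ∈ A, α ^ 2 / 2 * #A ^ 2 + #{p ∈ bad | R p.1 b ∧ R p.2 b} / ε
      ≤ (#(U b) : ℝ) ^ 2 := by
    apply exists_le_of_sum_le hA
    rw [sum_add_distrib, sum_const, nsmul_eq_mul, ← sum_div]
    have : (∑ b ∈ A, (#{p ∈ bad | R p.1 b ∧ R p.2 b} : ℝ)) / ε ≤ α ^ 2 / 2 * #A ^ 3 := by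
      rw [div_le_iff₀ hε]
      linarith
    nlinarith
  have hbadle : 0 ≤ (#{p ∈ bad | R p.1 b ∧ R p.2 b} : ℝ) / ε := by positivity
  refine ⟨U b, filter_subset _ _, by linarith, ?_⟩
  have h1 : (#{p ∈ bad | R p.1 b ∧ R p.2 b} : ℝ) / ε ≤ (#(U b) : ℝ) ^ 2 := by
    have : 0 ≤ α ^ 2 / 2 * (#A : ℝ) ^ 2 := by positivity
    linarith
  rw [div_le_iff₀ hε] at h1
  refine le_trans (Nat.cast_le.2 (card_le_card fun p hp => ?_)) (h1.trans_eq (mul_comm _ _))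
  simp only [hU, hbad, mem_filter, mem_product] at hp ⊢
  tauto

open Finset in
open scoped Classical in
/-- A dense symmetric relation has many paths of length four between any two vertices of some large
set. -/
theorem exists_large_subset_many_paths {V : Type*} (A : Finset V) (R : V → V → Prop)
    {α : ℝ} (hα : 0 < α) (hA : A.Nonempty) (h : α * #A ^ 2 ≤ #{p ∈ A ×ˢ A | R p.1 p.2}) :
    ∃ A' ⊆ A, α / 4 * #A ≤ #A' ∧ ∀ a ∈ A', ∀ a' ∈ A', α ^ 5 / 1024 * #A ^ 3 ≤
      #{q ∈ A ×ˢ A ×ˢ A | (R a q.2.1 ∧ R q.1 q.2.1) ∧ (R q.1 q.2.2 ∧ R a' q.2.2)} := by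
  have hN : 0 < (#A : ℝ) := by exact_mod_cast hA.card_pos
  obtain ⟨U, hUA, hU, hbad⟩ :=
    exists_large_subset_few_bad_pairs A R hα (by norm_num : (0 : ℝ) < 1 / 8) hA h
  set η : ℝ := 1 / 8 * α ^ 2 / 2 * #A with hη
  set B : V → Finset V := fun a => U.filter fun c => (#{b ∈ A | R a b ∧ R c b} : ℝ) < η with hB
  have hUN : α / 2 * #A ≤ #U := by
    refine (sq_le_sq₀ (by positivity) (by positivity)).1 ?_
    nlinarith [sq_nonneg (α * #A)]
  have hUpos : 0 < (#U : ℝ) := lt_of_lt_of_le (by positivity) hUN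
  have hBsum : ∑ a ∈ U, (#(B a) : ℝ) ≤ 1 / 8 * #U ^ 2 := by
    refine le_trans (le_of_eq ?_) hbad
    rw [card_filter, sum_product]
    push_cast [hB, card_filter]
    rfl
  set A' := U.filter fun a => (#(B a) : ℝ) ≤ #U / 4 with hA'
  have hA'U : (#U : ℝ) / 2 ≤ #A' := by
    have h1 : (#(U.filter fun a => ¬ (#(B a) : ℝ) ≤ #U / 4) : ℝ) * (#U / 4) ≤ 1 / 8 * #U ^ 2 := by
      refine le_trans ?_ hBsum
      rw [← nsmul_eq_mul]
      refine (card_nsmul_le_sum _ (fun a => (#(B a) : ℝ)) _ fun a ha => ?_).trans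
        (sum_le_sum_of_subset_of_nonneg (filter_subset _ _) fun _ _ _ => by positivity)
      exact (not_le.1 (mem_filter.1 ha).2).le
    have h2 : (#A' : ℝ) + #(U.filter fun a => ¬ (#(B a) : ℝ) ≤ #U / 4) = #U := by
      exact_mod_cast card_filter_add_card_filter_not (s := U) fun a => (#(B a) : ℝ) ≤ #U / 4
    have h3 : (#(U.filter fun a => ¬ (#(B a) : ℝ) ≤ #U / 4) : ℝ) ≤ #U / 2 := by
      refine le_of_mul_le_mul_right (a := (#U : ℝ) / 4) ?_ (by positivity)
      linarith
    linarith
  refine ⟨A', (filter_subset _ _).trans hUA, by linarith, fun a ha a' ha' => ?_⟩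
  set W := U \ (B a ∪ B a') with hW
  have hWU : (#U : ℝ) / 2 ≤ #W := by
    have h1 := le_card_sdiff (B a ∪ B a') U
    rw [← hW] at h1
    have h2 := card_union_le (B a) (B a')
    have h3 : (#U : ℝ) ≤ #W + (#(B a) + #(B a')) := by
      exact_mod_cast (by omega : #U ≤ #W + (#(B a) + #(B a')))
    linarith [(mem_filter.1 ha).2, (mem_filter.1 ha').2]
  have hWgood : ∀ c ∈ W, η * η ≤ #{b ∈ A | R a b ∧ R c b} * #{b ∈ A | R c b ∧ R a' b} := by
    intro c hc
    simp only [hW, hB, mem_sdiff, mem_union, mem_filter, not_or, not_and, not_lt] at hc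
    have h1 := hc.2.1 hc.1
    have h2 := hc.2.2 hc.1
    simp only [and_comm (a := R a' _)] at h2
    gcongr
  calc α ^ 5 / 1024 * (#A : ℝ) ^ 3 = (α / 4 * #A) * (η * η) := by rw [hη]; ring
    _ ≤ #W * (η * η) := by gcongr; linarith
    _ = ∑ c ∈ W, η * η := by rw [sum_const, nsmul_eq_mul]
    _ ≤ ∑ c ∈ W, (#{b ∈ A | R a b ∧ R c b} * #{b ∈ A | R c b ∧ R a' b} : ℝ) :=
      sum_le_sum hWgood
    _ ≤ ∑ c ∈ A, (#{b ∈ A | R a b ∧ R c b} * #{b ∈ A | R c b ∧ R a' b} : ℝ) :=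
      sum_le_sum_of_subset_of_nonneg (sdiff_subset.trans hUA) fun _ _ _ => by positivity
    _ = _ := by
      rw [card_filter, sum_product, Nat.cast_sum]
      refine sum_congr rfl fun c _ => ?_
      rw [← Nat.cast_mul, ← card_product, ← filter_product, card_filter]

open Finset in
/-- The additive energy counts pairs of pairs with the same difference. -/
theorem sum_card_representations_eq {G : Type*} [AddCommGroup G] [DecidableEq G] (A : Finset G) :
    ∑ p ∈ A ×ˢ A, #{q ∈ A ×ˢ A | q.1 - q.2 = p.1 - p.2} = A.addEnergy A := by
  rw [addEnergy, card_filter, sum_product (A ×ˢ A) (A ×ˢ A)]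
  refine sum_congr rfl fun p _ => ?_
  rw [card_filter, sum_product, sum_product_right]
  refine sum_congr rfl fun x _ => sum_congr rfl fun y _ => ?_
  congr 1
  rw [sub_eq_sub_iff_add_eq_add, eq_iff_iff]
  constructor <;> intro h
  · rw [← h, add_comm]
  · rw [h, add_comm]

open Finset in
open scoped Classical Pointwise in
/-- The **Balog-Szemerédi-Gowers theorem**. -/
theorem exists_subset_card_sub_le {G : Type*} [AddCommGroup G] [DecidableEq G] (A : Finset G)
    {α : ℝ} (hα : 0 < α) (hA : A.Nonempty) (hE : 2 * α * #A ^ 3 ≤ A.addEnergy A) :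
    ∃ A' ⊆ A, α / 4 * #A ≤ #A' ∧ (#(A' - A') : ℝ) ≤ 1024 / α ^ 9 * #A := by
  have hN : 0 < (#A : ℝ) := by exact_mod_cast hA.card_pos
  set r : G → ℕ := fun x => #{q ∈ A ×ˢ A | q.1 - q.2 = x} with hr
  set R : G → G → Prop := fun a b => α * #A ≤ r (a - b) with hR
  have hrle : ∀ x, r x ≤ #A := by
    intro x
    refine card_le_card_of_injOn Prod.fst (fun q hq => ?_) fun q hq q' hq' h => ?_
    · exact (mem_product.1 (mem_filter.1 hq).1).1
    · have h1 := (mem_filter.1 hq).2.trans (mem_filter.1 hq').2.symm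
      rw [h] at h1
      exact Prod.ext h (sub_right_injective h1)
  have hedges : α * #A ^ 2 ≤ (#{p ∈ A ×ˢ A | R p.1 p.2} : ℝ) := by
    have h1 : (A.addEnergy A : ℝ) = ∑ p ∈ A ×ˢ A, (r (p.1 - p.2) : ℝ) := by
      rw [← sum_card_representations_eq]
      push_cast
      rfl
    have h2 : ∑ p ∈ A ×ˢ A, (r (p.1 - p.2) : ℝ)
        ≤ ∑ p ∈ A ×ˢ A, ((if R p.1 p.2 then (#A : ℝ) else 0) + α * #A) := by
      refine sum_le_sum fun p _ => ?_
      split_ifs with h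
      · have : (r (p.1 - p.2) : ℝ) ≤ #A := by exact_mod_cast hrle _
        have : 0 ≤ α * #A := by positivity
        linarith
      · rw [zero_add]
        exact (not_le.1 h).le
    rw [sum_add_distrib, ← sum_filter, sum_const, sum_const, nsmul_eq_mul, nsmul_eq_mul,
      card_product] at h2
    push_cast at h2
    refine le_of_mul_le_mul_right ?_ hN
    linarith
  obtain ⟨A', hA'A, hA', hpath⟩ := exists_large_subset_many_paths A R hα hA hedges
  refine ⟨A', hA'A, hA', ?_⟩
  set D := (A - A).filter fun x => α * #A ≤ r x with hD
  have hDcard : #D * (α * #A) ≤ (#A : ℝ) ^ 2 := by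
    rw [← nsmul_eq_mul]
    refine (card_nsmul_le_sum D (fun x => (r x : ℝ)) _ fun x hx => (mem_filter.1 hx).2).trans ?_
    have := sum_card_fiberwise_eq_card_filter (A ×ˢ A) D fun q => q.1 - q.2
    rw [← Nat.cast_sum]
    calc ((∑ x ∈ D, r x : ℕ) : ℝ) ≤ ((#(A ×ˢ A) : ℕ) : ℝ) := by
          rw [this]
          exact_mod_cast card_filter_le _ _
      _ = _ := by rw [card_product]; push_cast; ring
  have hRD : ∀ a ∈ A, ∀ b ∈ A, R a b → a - b ∈ D := fun a ha b hb h =>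
    mem_filter.2 ⟨sub_mem_sub ha hb, h⟩
  set D4 := D ×ˢ D ×ˢ D ×ˢ D with hD4
  have hfib : ∀ x ∈ A' - A', α ^ 5 / 1024 * (#A : ℝ) ^ 3 ≤
      #{q ∈ D4 | q.1 - q.2.1 + q.2.2.1 - q.2.2.2 = x} := by
    intro x hx
    obtain ⟨a, ha, a', ha', rfl⟩ := mem_sub.1 hx
    refine (hpath a ha a' ha').trans (Nat.cast_le.2 ?_)
    refine card_le_card_of_injOn
      (fun q => (a - q.2.1, q.1 - q.2.1, q.1 - q.2.2, a' - q.2.2)) (fun q hq => ?_) ?_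
    · simp only [coe_filter, mem_product, Set.mem_ofPred_eq] at hq
      obtain ⟨⟨h1, h2, h3⟩, ⟨e1, e2⟩, e3, e4⟩ := hq
      simp only [hD4, coe_filter, mem_product, Set.mem_ofPred_eq]
      refine ⟨⟨hRD _ (hA'A ha) _ h2 e1, hRD _ h1 _ h2 e2, hRD _ h1 _ h3 e3,
        hRD _ (hA'A ha') _ h3 e4⟩, by abel⟩
    · rintro ⟨c, b, b'⟩ - ⟨e, f, f'⟩ - h
      simp only [Prod.mk.injEq, sub_right_inj] at h
      obtain ⟨rfl, h2, -, rfl⟩ := h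
      rw [sub_left_inj] at h2
      rw [h2]
  have hmul : #(A' - A') * (α ^ 5 / 1024 * (#A : ℝ) ^ 3) ≤ (#D : ℝ) ^ 4 := by
    rw [← nsmul_eq_mul]
    refine (card_nsmul_le_sum _ _ _ hfib).trans ?_
    rw [← Nat.cast_sum, sum_card_fiberwise_eq_card_filter D4 (A' - A')
      fun q => q.1 - q.2.1 + q.2.2.1 - q.2.2.2]
    calc ((#{q ∈ D4 | q.1 - q.2.1 + q.2.2.1 - q.2.2.2 ∈ A' - A'} : ℕ) : ℝ) ≤ (#D4 : ℕ) := by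
          exact_mod_cast card_filter_le _ _
      _ = _ := by simp only [hD4, card_product]; push_cast; ring
  have hD1 : (#D : ℝ) ≤ #A / α := by
    rw [le_div_iff₀ hα]
    refine le_of_mul_le_mul_right ?_ hN
    linarith
  have hD4' : (#D : ℝ) ^ 4 ≤ (#A / α) ^ 4 := by gcongr
  have hpos : 0 < α ^ 5 / 1024 * (#A : ℝ) ^ 3 := by positivity
  refine le_of_mul_le_mul_right ((hmul.trans hD4').trans_eq ?_) hpos
  field_simp

open scoped Pointwise in
/-- A Freiman isomorphism of order `8` on `A` induces one of order `2` on `2A - 2A`. -/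
theorem exists_lift_two_sub_two {m : ℕ} {A : Finset ℤ} {φ : ℤ → ZMod m}
    (hφ : ∀ s t : Multiset ℤ, (∀ x ∈ s, x ∈ A) → (∀ x ∈ t, x ∈ A) → Multiset.card s = 8 →
      Multiset.card t = 8 → ((s.map φ).sum = (t.map φ).sum ↔ s.sum = t.sum))
    {P : Finset (ZMod m)} (hP : P = A.image φ + A.image φ - (A.image φ + A.image φ)) :
    ∃ ψ : ZMod m → ℤ, (∀ y ∈ P, ψ y ∈ 2 • A - 2 • A) ∧
      ∀ y₁ ∈ P, ∀ y₂ ∈ P, ∀ y₃ ∈ P, ∀ y₄ ∈ P,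
        (y₁ + y₂ = y₃ + y₄ ↔ ψ y₁ + ψ y₂ = ψ y₃ + ψ y₄) := by
  subst hP
  have hlift : ∀ y : ZMod m, ∃ z : ℤ, y ∈ A.image φ + A.image φ - (A.image φ + A.image φ) →
      ∃ a ∈ A, ∃ b ∈ A, ∃ c ∈ A, ∃ d ∈ A,
        y = φ a + φ b - (φ c + φ d) ∧ z = a + b - (c + d) := by
    intro y
    by_cases hy : y ∈ A.image φ + A.image φ - (A.image φ + A.image φ)
    · obtain ⟨u, hu, v, hv, rfl⟩ := Finset.mem_sub.1 hy
      obtain ⟨u₁, hu₁, u₂, hu₂, rfl⟩ := Finset.mem_add.1 hu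
      obtain ⟨v₁, hv₁, v₂, hv₂, rfl⟩ := Finset.mem_add.1 hv
      obtain ⟨a, ha, rfl⟩ := Finset.mem_image.1 hu₁
      obtain ⟨b, hb, rfl⟩ := Finset.mem_image.1 hu₂
      obtain ⟨c, hc, rfl⟩ := Finset.mem_image.1 hv₁
      obtain ⟨d, hd, rfl⟩ := Finset.mem_image.1 hv₂
      exact ⟨_, fun _ => ⟨a, ha, b, hb, c, hc, d, hd, rfl, rfl⟩⟩
    · exact ⟨0, fun h => absurd h hy⟩
  choose ψ hψ using hlift
  refine ⟨ψ, ?_, ?_⟩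
  · intro y hy
    obtain ⟨a, ha, b, hb, c, hc, d, hd, -, h⟩ := hψ y hy
    rw [h, two_nsmul]
    exact Finset.sub_mem_sub (Finset.add_mem_add ha hb) (Finset.add_mem_add hc hd)
  · intro y₁ hy₁ y₂ hy₂ y₃ hy₃ y₄ hy₄
    obtain ⟨a₁, ha₁, b₁, hb₁, c₁, hc₁, d₁, hd₁, e₁, h₁⟩ := hψ y₁ hy₁
    obtain ⟨a₂, ha₂, b₂, hb₂, c₂, hc₂, d₂, hd₂, e₂, h₂⟩ := hψ y₂ hy₂
    obtain ⟨a₃, ha₃, b₃, hb₃, c₃, hc₃, d₃, hd₃, e₃, h₃⟩ := hψ y₃ hy₃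
    obtain ⟨a₄, ha₄, b₄, hb₄, c₄, hc₄, d₄, hd₄, e₄, h₄⟩ := hψ y₄ hy₄
    have key := hφ {a₁, b₁, a₂, b₂, c₃, d₃, c₄, d₄} {a₃, b₃, a₄, b₄, c₁, d₁, c₂, d₂}
      (by simp [*]) (by simp [*]) rfl rfl
    simp only [Multiset.insert_eq_cons, Multiset.map_cons, Multiset.map_singleton,
      Multiset.sum_cons, Multiset.sum_singleton] at key
    rw [h₁, h₂, h₃, h₄, e₁, e₂, e₃, e₄]
    constructor
    · intro h
      have := key.1 (by linear_combination h)
      linarith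
    · intro h
      have := key.2 (by linarith)
      linear_combination this

/-- A map on a box of integer points respecting additive quadruples is affine. -/
theorem eq_add_sum_of_additive_on_box {d : ℕ} (L : Fin d → ℕ) (f : (Fin d → ℕ) → ℤ)
    (hf : ∀ n₁ n₂ n₃ n₄ : Fin d → ℕ, (∀ i, n₁ i < L i) → (∀ i, n₂ i < L i) → (∀ i, n₃ i < L i) →
      (∀ i, n₄ i < L i) → n₁ + n₂ = n₃ + n₄ → f n₁ + f n₂ = f n₃ + f n₄)
    (n : Fin d → ℕ) (hn : ∀ i, n i < L i) :
    f n = f 0 + ∑ i, (n i : ℤ) * (f (Pi.single i 1) - f 0) := by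
  induction hN : ∑ i, n i generalizing n with
  | zero =>
    have : n = 0 := by
      funext i
      exact Finset.sum_eq_zero_iff.1 hN i (Finset.mem_univ i)
    simp [this]
  | succ N ih =>
    obtain ⟨i, hi⟩ : ∃ i, n i ≠ 0 := by
      by_contra! h
      simp [h] at hN
    obtain ⟨n', rfl⟩ : ∃ n', n = n' + Pi.single i 1 := by
      refine ⟨n - Pi.single i 1, (tsub_add_cancel_of_le ?_).symm⟩
      intro j
      rcases eq_or_ne j i with rfl | hj
      · rw [Pi.single_eq_same]
        exact Nat.one_le_iff_ne_zero.2 hi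
      · rw [Pi.single_eq_of_ne hj]
        exact Nat.zero_le _
    have hn' : ∀ j, n' j < L j := fun j => lt_of_le_of_lt (Nat.le_add_right _ _) (hn j)
    have hsingle : ∀ j, (Pi.single i 1 : Fin d → ℕ) j < L j :=
      fun j => lt_of_le_of_lt (Nat.le_add_left _ _) (hn j)
    have hsum : ∑ j, n' j = N := by
      simp only [Pi.add_apply, Finset.sum_add_distrib, Finset.sum_pi_single', Finset.mem_univ,
        if_true] at hN
      omega
    have h1 := hf (n' + Pi.single i 1) 0 n' (Pi.single i 1) hn
      (fun j => Nat.zero_lt_of_lt (hn j)) hn' hsingle (add_zero _)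
    rw [ih n' hn' hsum] at h1
    have h2 : ∑ j, ((n' + Pi.single i 1 : Fin d → ℕ) j : ℤ) * (f (Pi.single j 1) - f 0)
        = ∑ j, (n' j : ℤ) * (f (Pi.single j 1) - f 0) + (f (Pi.single i 1) - f 0) := by
      simp [Pi.single_apply, add_mul, Finset.sum_add_distrib]
    rw [h2]
    linarith

open Finset in
open scoped Pointwise in
/-- Some translate of `Q` meets `A` in at least `#A * #Q / #(A - Q)` points. -/
theorem exists_card_mul_card_le_card_sub_mul_card_inter_vadd {G : Type*} [AddCommGroup G]
    [DecidableEq G] {A Q : Finset G} (hA : A.Nonempty) (hQ : Q.Nonempty) :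
    ∃ t : G, #A * #Q ≤ #(A - Q) * #(A ∩ (t +ᵥ Q)) := by
  obtain ⟨t, -, ht⟩ := exists_le_of_sum_le (s := A - Q) (hA.sub hQ) (f := fun _ => #A * #Q)
    (g := fun t => #(A - Q) * #{p ∈ A ×ˢ Q | p.1 - p.2 = t}) (by
      rw [sum_const, ← mul_sum, sum_card_fiberwise_eq_card_filter, smul_eq_mul,
        filter_true_of_mem, card_product]
      rintro ⟨a, q⟩ h
      exact sub_mem_sub (mem_product.1 h).1 (mem_product.1 h).2)
  refine ⟨t, ht.trans (Nat.mul_le_mul_left _ ?_)⟩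
  refine card_le_card_of_injOn Prod.fst (fun p hp => ?_) fun p hp p' hp' h => ?_
  · obtain ⟨h1, rfl⟩ := mem_filter.1 hp
    rw [mem_coe, mem_inter, mem_vadd_finset]
    exact ⟨(mem_product.1 h1).1, p.2, (mem_product.1 h1).2, by simp⟩
  · have h1 := (mem_filter.1 hp).2.trans (mem_filter.1 hp').2.symm
    rw [h] at h1
    exact Prod.ext h (sub_right_injective h1)

theorem genAP_subset_genAP_of_le {d D : ℕ} (hdD : d ≤ D) (h : ℤ) (k s : Fin d → ℤ) :
    ∃ k' s' : Fin D → ℤ, genAP d h k s ⊆ genAP D h k' s' ∧ ∏ j, s' j = ∏ j, s j := by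
  obtain ⟨e, rfl⟩ := Nat.exists_eq_add_of_le hdD
  refine ⟨Fin.append k 0, Fin.append s 1, ?_, by simp [Fin.prod_univ_add]⟩
  rintro x ⟨r, hr, rfl⟩
  refine ⟨Fin.append r 0, fun j => ?_, by simp [Fin.sum_univ_add]⟩
  induction j using Fin.addCases with
  | left j => simpa using hr j
  | right j => simp

open Finset in
open scoped Pointwise in
theorem card_nsmul_sub_nsmul_le {A : Finset ℤ} (hA : A.Nonempty) {K : ℝ}
    (hK : (#(A - A) : ℝ) ≤ K * #A) (m n : ℕ) :
    (#(m • A - n • A) : ℝ) ≤ K ^ (m + n) * #A := by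
  have hN : 0 < (#A : ℝ) := by exact_mod_cast hA.card_pos
  have h : ((#(m • A - n • A) : ℚ≥0) : ℝ) ≤ (((#(A - A) / #A : ℚ≥0) ^ (m + n) * #A : ℚ≥0) : ℝ) := by
    exact_mod_cast pluennecke_ruzsa_inequality_nsmul_sub_nsmul_sub hA A m n
  push_cast at h
  refine h.trans ?_
  gcongr
  rwa [div_le_iff₀ hN]

open Finset in
open scoped Pointwise in
/-- A set of integers with a dense Freiman model contains, in `2A - 2A`, a large proper
progression of bounded dimension. -/
theorem exists_progression_two_sub_two {m : ℕ} [NeZero m] {A : Finset ℤ} (hA : A.Nonempty)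
    {φ : ℤ → ZMod m} (hφ : ∀ s t : Multiset ℤ, (∀ x ∈ s, x ∈ A) → (∀ x ∈ t, x ∈ A) →
      Multiset.card s = 8 → Multiset.card t = 8 → ((s.map φ).sum = (t.map φ).sum ↔ s.sum = t.sum))
    {D : ℕ} (hD : 2 * (m / #A : ℝ) ^ 2 + 1 ≤ D) :
    ∃ d ≤ D, ∃ (h : ℤ) (k : Fin d → ℤ) (L : Fin d → ℕ) (Q : Finset ℤ), Q.Nonempty ∧
      Q ⊆ 2 • A - 2 • A ∧ #Q = ∏ i, L i ∧ (Q : Set ℤ) ⊆ genAP d h k (fun i => L i) ∧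
      (m : ℝ) ≤ 4 ^ D * (3 ^ (D ^ 2) * (D + 1 : ℝ) ^ D) * #Q := by
  have hinj : Set.InjOn φ A := by
    intro x hx y hy hxy
    have := (hφ (Multiset.replicate 8 x) (Multiset.replicate 8 y)
      (fun z hz => by rwa [Multiset.eq_of_mem_replicate hz])
      (fun z hz => by rwa [Multiset.eq_of_mem_replicate hz]) (by simp) (by simp)).1 (by simp [hxy])
    simp only [Multiset.sum_replicate, nsmul_eq_mul] at this
    omega
  obtain ⟨Γ, h1, hΓ, hΓB⟩ := exists_bohr_subset_two_sub_two (hA.image φ)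
  rw [card_image_of_injOn hinj] at hΓ
  have hΓD : #Γ ≤ D := by exact_mod_cast hΓ.trans hD
  obtain ⟨d, hd, x, L, hL, hbohr, hproper, hsize⟩ := exists_progression_bohr h1
  obtain ⟨ψ, hψA, hψ⟩ := exists_lift_two_sub_two hφ rfl
  set y : (Fin d → ℕ) → ZMod m := fun n => ∑ i, (n i : ZMod m) * x i with hy
  have hyP : ∀ n : Fin d → ℕ, (∀ i, n i < L i) →
      y n ∈ A.image φ + A.image φ - (A.image φ + A.image φ) := by
    intro n hn
    obtain ⟨a, ha, b, hb, c, hc, e, he, h⟩ := hΓB _ (hbohr n hn)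
    rw [hy]
    simp only
    rw [h, sub_sub]
    exact sub_mem_sub (add_mem_add ha hb) (add_mem_add hc he)
  have hy_add : ∀ n n' : Fin d → ℕ, y (n + n') = y n + y n' := by
    intro n n'
    simp [hy, add_mul, sum_add_distrib]
  have haffine := eq_add_sum_of_additive_on_box L (fun n => ψ (y n))
    fun n₁ n₂ n₃ n₄ hn₁ hn₂ hn₃ hn₄ h =>
      (hψ _ (hyP n₁ hn₁) _ (hyP n₂ hn₂) _ (hyP n₃ hn₃) _ (hyP n₄ hn₄)).1 (by
        rw [← hy_add, h, hy_add])
  set box : Finset (Fin d → ℕ) := Fintype.piFinset fun i => range (L i) with hbox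
  have hmem : ∀ n ∈ box, ∀ i, n i < L i := fun n hn i => by
    simpa using Fintype.mem_piFinset.1 hn i
  have hψinj : Set.InjOn (fun n => ψ (y n)) box := by
    intro n hn n' hn' h
    refine hproper n n' (hmem n hn) (hmem n' hn') ?_
    have := (hψ _ (hyP n (hmem n hn)) _ (hyP n (hmem n hn)) _ (hyP n' (hmem n' hn'))
      _ (hyP n (hmem n hn))).2 (by rw [show ψ (y n) = ψ (y n') from h])
    exact add_right_cancel this
  have hcard : #(box.image fun n => ψ (y n)) = ∏ i, L i := by
    rw [card_image_of_injOn hψinj, hbox, Fintype.card_piFinset]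
    simp
  refine ⟨d, hd.trans hΓD, ψ (y 0), fun i => ψ (y (Pi.single i 1)) - ψ (y 0), L,
    box.image fun n => ψ (y n), ?_, ?_, hcard, ?_, ?_⟩
  · rw [image_nonempty, hbox, Fintype.piFinset_nonempty]
    exact fun i => nonempty_range_iff.2 (hL i).ne'
  · intro z hz
    obtain ⟨n, hn, rfl⟩ := mem_image.1 hz
    exact hψA _ (hyP n (hmem n hn))
  · intro z hz
    obtain ⟨n, hn, rfl⟩ := mem_image.1 (mem_coe.1 hz)
    exact ⟨fun i => n i, fun i => ⟨by positivity, Nat.cast_lt.2 (hmem n hn i)⟩,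
      haffine n (hmem n hn)⟩
  · rw [hcard]
    push_cast
    refine hsize.trans ?_
    have hΓD' : (#Γ + 1 : ℝ) ^ #Γ ≤ (D + 1 : ℝ) ^ D :=
      (pow_le_pow_right₀ (by simp) hΓD).trans (by gcongr)
    gcongr <;> norm_num

open Finset in
open scoped Pointwise in
/-- **Freiman's theorem**, in the weak form where a set of small doubling has a large intersection
with a progression of comparable size. -/
theorem exists_subset_genAP_of_card_sub_le {K : ℝ} (hK : 0 < K) :
    ∃ D : ℕ, 0 < D ∧ ∃ C : ℝ, 0 < C ∧ ∃ K' : ℝ, 0 < K' ∧ ∀ A : Finset ℤ, A.Nonempty →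
      (#(A - A) : ℝ) ≤ K * #A → ∃ A' ⊆ A, C * #A ≤ #A' ∧ ∃ (h : ℤ) (k s : Fin D → ℤ),
        (A' : Set ℤ) ⊆ genAP D h k s ∧ ((∏ j, s j : ℤ) : ℝ) ≤ K' * #A := by
  set M : ℝ := 32 * K ^ 16 with hM
  obtain ⟨D, hD⟩ := exists_nat_ge (2 * M ^ 2 + 1)
  set F : ℝ := 4 ^ D * (3 ^ (D ^ 2) * (D + 1 : ℝ) ^ D) with hF
  have hFpos : 0 < F := by positivity
  have hDpos : 0 < D := by
    have : (0 : ℝ) < D := lt_of_lt_of_le (by positivity) hD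
    exact_mod_cast this
  refine ⟨D, hDpos, 1 / (2 * F * K ^ 5), by positivity, K ^ 4, by positivity, fun A hA hAK => ?_⟩
  have hN : 0 < (#A : ℝ) := by exact_mod_cast hA.card_pos
  have hA8 : #A ≤ #(8 • A - 8 • A) := by
    obtain ⟨a, ha⟩ := hA
    have h8 : 8 • A - 8 • A = A + (7 • A - 8 • A) := by
      rw [show (8 : ℕ) • A = A + 7 • A by rw [← succ_nsmul'], add_sub_assoc]
    rw [h8]
    have : (7 • A - 8 • A).Nonempty := (Nonempty.nsmul ⟨a, ha⟩).sub (Nonempty.nsmul ⟨a, ha⟩)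
    exact card_le_card_add_right this
  obtain ⟨m, hm⟩ : ∃ m, m = 4 * #(8 • A - 8 • A) := ⟨_, rfl⟩
  have hmpos : 0 < m := by
    have := hA.card_pos
    omega
  have : NeZero m := ⟨hmpos.ne'⟩
  have hmle : (m : ℝ) ≤ 4 * (K ^ 16 * #A) := by
    rw [hm]
    push_cast
    have : (#(8 • A - 8 • A) : ℝ) ≤ K ^ 16 * #A := card_nsmul_sub_nsmul_le hA hAK 8 8
    linarith
  have hmge : 4 * (#A : ℝ) ≤ m := by
    rw [hm]
    exact_mod_cast Nat.mul_le_mul_left 4 hA8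
  obtain ⟨A₁, hA₁A, hA₁, φ, hφ⟩ := exists_freiman_model A hmpos hm.ge
  have hA₁' : (#A : ℝ) ≤ 8 * #A₁ := by exact_mod_cast hA₁
  have hN₁ : 0 < (#A₁ : ℝ) := by linarith
  have hA₁ne : A₁.Nonempty := card_pos.1 (by exact_mod_cast hN₁)
  have hmM : 2 * (m / #A₁ : ℝ) ^ 2 + 1 ≤ D := by
    refine le_trans ?_ hD
    gcongr
    rw [div_le_iff₀ hN₁, hM]
    calc (m : ℝ) ≤ 4 * (K ^ 16 * (8 * #A₁)) := hmle.trans (by gcongr)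
      _ = _ := by ring
  obtain ⟨d, hdD, h, k, L, Q, hQ, hQA, hQcard, hQgen, hmQ⟩ :=
    exists_progression_two_sub_two hA₁ne hφ hmM
  obtain ⟨t, ht⟩ := exists_card_mul_card_le_card_sub_mul_card_inter_vadd hA₁ne hQ
  obtain ⟨k', s', hsub, hprod⟩ := genAP_subset_genAP_of_le hdD (t + h) k fun i => L i
  refine ⟨A₁ ∩ (t +ᵥ Q), inter_subset_left.trans hA₁A, ?_, t + h, k', s', ?_, ?_⟩
  · have hsubset : A₁ - Q ⊆ 3 • A - 2 • A := by
      rw [show (3 : ℕ) • A = A + 2 • A by rw [← succ_nsmul'], add_sub_assoc]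
      intro z hz
      obtain ⟨a, ha, q, hq, rfl⟩ := mem_sub.1 hz
      obtain ⟨u, hu, v, hv, rfl⟩ := mem_sub.1 (hQA hq)
      rw [show a - (u - v) = a + (v - u) by ring]
      exact add_mem_add (hA₁A ha) (sub_mem_sub (nsmul_subset_nsmul_left hA₁A hv)
        (nsmul_subset_nsmul_left hA₁A hu))
    have h1 : (#(A₁ - Q) : ℝ) ≤ K ^ 5 * #A :=
      (Nat.cast_le.2 (card_le_card hsubset)).trans (card_nsmul_sub_nsmul_le hA hAK 3 2)
    have h2 : (#A₁ * #Q : ℝ) ≤ K ^ 5 * #A * #(A₁ ∩ (t +ᵥ Q)) := by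
      refine le_trans (by exact_mod_cast ht) (mul_le_mul_of_nonneg_right h1 (by positivity))
    have h3 : 4 * (#A : ℝ) ≤ F * #Q := hmge.trans hmQ
    rw [div_mul_eq_mul_div, one_mul, div_le_iff₀ (by positivity)]
    refine le_of_mul_le_mul_left ?_ hN
    calc (#A : ℝ) * #A ≤ 8 * #A₁ * (F * #Q / 4) := by gcongr; linarith
      _ = 2 * F * (#A₁ * #Q) := by ring
      _ ≤ 2 * F * (K ^ 5 * #A * #(A₁ ∩ (t +ᵥ Q))) := by gcongr
      _ = _ := by ring
  · intro z hz
    obtain ⟨q, hq, rfl⟩ := mem_vadd_finset.1 (mem_inter.1 (mem_coe.1 hz)).2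
    obtain ⟨r, hr, rfl⟩ := hQgen hq
    exact hsub ⟨r, hr, by rw [vadd_eq_add, add_assoc]⟩
  · rw [hprod]
    have h1 : (#Q : ℝ) ≤ K ^ 4 * #A :=
      (Nat.cast_le.2 (card_le_card (hQA.trans (sub_subset_sub (nsmul_subset_nsmul_left hA₁A)
        (nsmul_subset_nsmul_left hA₁A))))).trans (card_nsmul_sub_nsmul_le hA hAK 2 2)
    rw [hQcard] at h1
    exact_mod_cast h1

theorem additiveEnergy_eq_addEnergy (A : Finset ℤ) : additiveEnergy A = A.addEnergy A := by
  refine Finset.card_bij' (fun p _ => ((p.1.1, p.2.1), (p.1.2, p.2.2)))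
    (fun p _ => ((p.1.1, p.2.1), (p.1.2, p.2.2))) ?_ ?_ (fun _ _ => rfl) (fun _ _ => rfl) <;>
  · intro p hp
    simp only [Finset.mem_filter, Finset.mem_product] at hp ⊢
    tauto

open Finset in
/-- A set of integers of large additive energy has a large intersection with a progression of
bounded dimension and comparable size. -/
theorem exists_subset_genAP_of_le_additiveEnergy {κ : ℝ} (hκ : 0 < κ) :
    ∃ D : ℕ, 0 < D ∧ ∃ C : ℝ, 0 < C ∧ ∃ K : ℝ, 0 < K ∧ ∀ A : Finset ℤ, A.Nonempty →
      κ * #A ^ 3 ≤ (additiveEnergy A : ℝ) → ∃ A' ⊆ A, C * #A ≤ #A' ∧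
        ∃ (h : ℤ) (k s : Fin D → ℤ),
          (A' : Set ℤ) ⊆ genAP D h k s ∧ ((∏ j, s j : ℤ) : ℝ) ≤ K * #A := by
  set α := κ / 2 with hα
  have hαpos : 0 < α := by positivity
  obtain ⟨D, hD, C, hC, K, hK, H⟩ :=
    exists_subset_genAP_of_card_sub_le (K := 4096 / α ^ 10) (by positivity)
  refine ⟨D, hD, C * (α / 4), by positivity, K, hK, fun A hA hE => ?_⟩
  have hN : 0 < (#A : ℝ) := by exact_mod_cast hA.card_pos
  rw [additiveEnergy_eq_addEnergy] at hE
  obtain ⟨A₁, hA₁A, hA₁, hsub⟩ := exists_subset_card_sub_le A hαpos hA (by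
    rwa [show 2 * α = κ by rw [hα]; ring])
  have hA₁ne : A₁.Nonempty := by
    have : 0 < (#A₁ : ℝ) := lt_of_lt_of_le (by positivity) hA₁
    exact card_pos.1 (by exact_mod_cast this)
  obtain ⟨A₂, hA₂, hcard, h, k, s, hgen, hs⟩ := H A₁ hA₁ne (by
    refine hsub.trans ?_
    calc 1024 / α ^ 9 * (#A : ℝ) = 4096 / α ^ 10 * (α / 4 * #A) := by field_simp; norm_num
      _ ≤ _ := by gcongr)
  refine ⟨A₂, hA₂.trans hA₁A, ?_, h, k, s, hgen, hs.trans ?_⟩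
  · calc C * (α / 4) * (#A : ℝ) = C * (α / 4 * #A) := by ring
      _ ≤ C * #A₁ := by gcongr
      _ ≤ _ := hcard
  · gcongr

open Finset in
open scoped Pointwise in
/-- A nonempty subset of a progression has small doubling relative to the progression. -/
theorem card_add_self_le_of_subset_genAP {d : ℕ} {h : ℤ} {k s : Fin d → ℤ} {A : Finset ℤ}
    (hA : A.Nonempty) (hgen : (A : Set ℤ) ⊆ genAP d h k s) :
    (#(A + A) : ℤ) ≤ 2 ^ d * ∏ j, s j := by
  have hs : ∀ j, 0 < s j := by
    obtain ⟨a, ha⟩ := hA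
    obtain ⟨r, hr, -⟩ := hgen ha
    exact fun j => (hr j).1.trans_lt (hr j).2
  have hsub : A + A ⊆ (Fintype.piFinset fun j => Ico 0 (2 * s j)).image
      fun r => 2 * h + ∑ j, r j * k j := by
    intro z hz
    obtain ⟨a, ha, b, hb, rfl⟩ := mem_add.1 hz
    obtain ⟨r, hr, rfl⟩ := hgen ha
    obtain ⟨r', hr', rfl⟩ := hgen hb
    refine mem_image.2 ⟨r + r', Fintype.mem_piFinset.2 fun j => ?_, ?_⟩
    · have := hr j
      have := hr' j
      rw [mem_Ico, Pi.add_apply]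
      omega
    · simp only [Pi.add_apply, add_mul, sum_add_distrib]
      ring
  calc (#(A + A) : ℤ) ≤ (#(Fintype.piFinset fun j => Ico 0 (2 * s j)) : ℤ) := by
        exact_mod_cast (card_le_card hsub).trans card_image_le
    _ = ∏ j, (2 * s j) := by
        rw [Fintype.card_piFinset]
        push_cast
        refine prod_congr rfl fun j _ => ?_
        rw [Int.card_Ico, sub_zero, Int.toNat_of_nonneg (by linarith [hs j])]
    _ = _ := by rw [prod_mul_distrib, prod_const, card_univ, Fintype.card_fin]

open Finset in
open scoped Pointwise in
/-- A set with a large intersection with a progression of comparable size has large additive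
energy. -/
theorem le_additiveEnergy_of_subset_genAP {d : ℕ} {h : ℤ} {k s : Fin d → ℤ} {A B : Finset ℤ}
    {C K N : ℝ} (hC : 0 < C) (hK : 0 < K) (hN : 0 < N) (hAB : A ⊆ B) (hCA : C * N ≤ #A)
    (hgen : (A : Set ℤ) ⊆ genAP d h k s) (hs : ((∏ j, s j : ℤ) : ℝ) ≤ K * N) :
    C ^ 4 / (2 ^ d * K) * N ^ 3 ≤ (additiveEnergy B : ℝ) := by
  have hA : A.Nonempty := by
    have : 0 < (#A : ℝ) := lt_of_lt_of_le (by positivity) hCA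
    exact card_pos.1 (by exact_mod_cast this)
  have h1 : ((#A : ℝ) ^ 2 * #A ^ 2) ≤ 2 ^ d * (K * N) * additiveEnergy B := by
    have h2 : ((#A : ℝ) ^ 2 * #A ^ 2) ≤ (#(A + A) : ℝ) * A.addEnergy A := by
      exact_mod_cast le_card_add_mul_addEnergy A A
    have h3 : (#(A + A) : ℝ) ≤ 2 ^ d * ((∏ j, s j : ℤ) : ℝ) := by
      exact_mod_cast card_add_self_le_of_subset_genAP hA hgen
    have h4 : (A.addEnergy A : ℝ) ≤ additiveEnergy B := by
      rw [additiveEnergy_eq_addEnergy]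
      exact_mod_cast addEnergy_mono hAB hAB
    refine h2.trans (mul_le_mul (h3.trans ?_) h4 (by positivity) (by positivity))
    gcongr
  have h5 : (C * N) ^ 4 ≤ (#A : ℝ) ^ 4 := by gcongr
  rw [div_mul_eq_mul_div, div_le_iff₀ (by positivity)]
  refine le_of_mul_le_mul_left ?_ hN
  linarith

theorem card_firstElems {a : ℕ → ℕ} (hmono : ∀ m n, 1 ≤ m → m < n → a m < a n) (N : ℕ) :
    (firstElems a N).card = N := by
  rw [firstElems, Finset.card_image_of_injOn, Nat.card_Icc, Nat.add_sub_cancel]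
  intro m hm n hn h
  have hm1 := (Finset.mem_Icc.1 (Finset.mem_coe.1 hm)).1
  have hn1 := (Finset.mem_Icc.1 (Finset.mem_coe.1 hn)).1
  have h' : a m = a n := Nat.cast_injective h
  rcases lt_trichotomy m n with hlt | heq | hlt
  · have := hmono m n hm1 hlt
    omega
  · exact heq
  · have := hmono n m hn1 hlt
    omega

theorem mem_firstElems {a : ℕ → ℕ} {N : ℕ} {x : ℤ} :
    x ∈ firstElems a N ↔ ∃ n, 1 ≤ n ∧ n ≤ N ∧ (a n : ℤ) = x := by
  simp [firstElems, and_assoc]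

/-- For a strictly increasing sequence of positive integers, `E(A_N) = Ω(N³)` holds
if and only if the sequence is quasi-arithmetic of some degree `d`. -/
theorem energy_omega_iff_quasi_arithmetic
    (a : ℕ → ℕ)
    (hmono : ∀ m n, 1 ≤ m → m < n → a m < a n)
    (hpos : ∀ n, 1 ≤ n → 0 < a n) :
    (∃ κ : ℝ, 0 < κ ∧ ∃ N : ℕ → ℕ, StrictMono N ∧ (∀ i, 0 < N i) ∧
        ∀ i, κ * (N i : ℝ) ^ 3 ≤ (additiveEnergy (firstElems a (N i)) : ℝ)) ↔
    (∃ d : ℕ, 0 < d ∧ QuasiArithmetic a d) := by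
  constructor
  · rintro ⟨κ, hκ, N, hN, hNpos, hE⟩
    obtain ⟨d, hd, C, hC, K, hK, H⟩ := exists_subset_genAP_of_le_additiveEnergy hκ
    refine ⟨d, hd, C, K, hC, hK, N, hN, hNpos, fun i => ?_⟩
    have hcard := card_firstElems hmono (N i)
    obtain ⟨A, hA, hCA, h, k, s, hgen, hs⟩ := H (firstElems a (N i))
      (Finset.card_pos.1 (by rw [hcard]; exact hNpos i)) (by rw [hcard]; exact hE i)
    rw [hcard] at hCA hs
    exact ⟨A, fun x hx => mem_firstElems.1 (hA hx), hCA, h, k, s, hgen, hs⟩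
  · rintro ⟨d, -, C, K, hC, hK, N, hN, hNpos, H⟩
    refine ⟨C ^ 4 / (2 ^ d * K), by positivity, N, hN, hNpos, fun i => ?_⟩
    obtain ⟨A, hA, hCA, h, k, s, hgen, hs⟩ := H i
    exact le_additiveEnergy_of_subset_genAP hC hK (by exact_mod_cast hNpos i)
      (fun x hx => mem_firstElems.2 (hA x hx)) hCA hgen hs
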